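/- Let (A,Ω) be a relative fractal drum in ℝ^N such that D := dim_B(A,Ω) exists and D < N, and fix δ > 0. Let S be a screen with sup S < D, let U be an open connected neighborhood of the associated window W, and let F be a meromorphic extension of the distance zeta function ζ_{A,Ω}(·;δ) to U (i.e., F(s) = ζ_{A,Ω}(s;δ) for all s ∈ U with Re s > D) satisfying the languidity conditions (L1)–(L2) with some exponent κ_d ∈ ℝ. Assume that every pole ω of F in U with Re ω < D satisfies Re ω < S(Im ω) (so the screen passes strictly between the critical line {Re s = D} and all poles of F with real part strictly less than D). Then the following are equivalent: (a) (A,Ω) is Minkowski measurable; (b) D is the only pole of F on the critical line {Re s = D}, and it is simple. Moreover, if (a) or (b) holds, then M^D(A,Ω) = r/(N−D), where r := lim_{s→D}(s−D)F(s) is the residue of F at D. -/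

import Mathlib

open MeasureTheory Filter Complex Set Metric Topology Asymptotics
open scoped ENNReal NNReal

noncomputable section

/-- The open `t`-neighborhood `A_t = {x : dist(x,A) < t}` of a set `A ⊆ ℝ^N`. -/
def nbhd (N : ℕ) (A : Set (EuclideanSpace ℝ (Fin N))) (t : ℝ) :
    Set (EuclideanSpace ℝ (Fin N)) :=
  {x | Metric.infDist x A < t}

/-- The volume `|A_t ∩ Ω|` of the `t`-neighborhood of `A` relative to `Ω`. -/
def tubeVol (N : ℕ) (A Ω : Set (EuclideanSpace ℝ (Fin N))) (t : ℝ) : ℝ :=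
  (volume (nbhd N A t ∩ Ω)).toReal

/-- The upper `r`-dimensional Minkowski content of the relative fractal drum `(A,Ω)`. -/
def upperContent (N : ℕ) (A Ω : Set (EuclideanSpace ℝ (Fin N))) (r : ℝ) : ℝ≥0∞ :=
  Filter.limsup
    (fun t : ℝ => volume (nbhd N A t ∩ Ω) / ENNReal.ofReal (t ^ ((N : ℝ) - r)))
    (nhdsWithin 0 (Set.Ioi 0))

/-- The lower `r`-dimensional Minkowski content of the relative fractal drum `(A,Ω)`. -/
def lowerContent (N : ℕ) (A Ω : Set (EuclideanSpace ℝ (Fin N))) (r : ℝ) : ℝ≥0∞ :=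
  Filter.liminf
    (fun t : ℝ => volume (nbhd N A t ∩ Ω) / ENNReal.ofReal (t ^ ((N : ℝ) - r)))
    (nhdsWithin 0 (Set.Ioi 0))

/-- `D` is the (finite) upper box (Minkowski) dimension of `(A,Ω)`:
the greatest lower bound of `{r : M^{*r}(A,Ω) = 0}`. -/
def IsUpperMinkDim (N : ℕ) (A Ω : Set (EuclideanSpace ℝ (Fin N))) (D : ℝ) : Prop :=
  IsGLB {r : ℝ | upperContent N A Ω r = 0} D

/-- `D` is the (finite) lower box (Minkowski) dimension of `(A,Ω)`. -/
def IsLowerMinkDim (N : ℕ) (A Ω : Set (EuclideanSpace ℝ (Fin N))) (D : ℝ) : Prop :=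
  IsGLB {r : ℝ | lowerContent N A Ω r = 0} D

/-- The box (Minkowski) dimension of `(A,Ω)` exists and equals `D`. -/
def IsMinkDim (N : ℕ) (A Ω : Set (EuclideanSpace ℝ (Fin N))) (D : ℝ) : Prop :=
  IsUpperMinkDim N A Ω D ∧ IsLowerMinkDim N A Ω D

/-- `(A,Ω)` is a relative fractal drum in `ℝ^N`. -/
def IsRFD (N : ℕ) (A Ω : Set (EuclideanSpace ℝ (Fin N))) : Prop :=
  A.Nonempty ∧ MeasurableSet Ω ∧ volume Ω < ⊤ ∧ ∃ δ₀ > (0 : ℝ), Ω ⊆ nbhd N A δ₀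

/-- The relative distance zeta function `ζ_{A,Ω}(s) = ∫_Ω d(x,A)^{s-N} dx`. -/
def distZeta (N : ℕ) (A Ω : Set (EuclideanSpace ℝ (Fin N))) (s : ℂ) : ℂ :=
  ∫ x in Ω, (Metric.infDist x A : ℂ) ^ (s - (N : ℂ))

/-- The relative distance zeta function with parameter `δ`:
`ζ_{A,Ω}(s;δ) = ∫_{A_δ ∩ Ω} d(x,A)^{s-N} dx`. -/
def distZetaD (N : ℕ) (A Ω : Set (EuclideanSpace ℝ (Fin N))) (δ : ℝ) (s : ℂ) : ℂ :=
  ∫ x in nbhd N A δ ∩ Ω, (Metric.infDist x A : ℂ) ^ (s - (N : ℂ))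

/-- The relative tube zeta function `ζ̃_{A,Ω}(s;δ) = ∫_0^δ t^{s-N-1}|A_t ∩ Ω| dt`. -/
def tubeZeta (N : ℕ) (A Ω : Set (EuclideanSpace ℝ (Fin N))) (δ : ℝ) (s : ℂ) : ℂ :=
  ∫ t in Set.Ioc (0 : ℝ) δ, (t : ℂ) ^ (s - (N : ℂ) - 1) * ((tubeVol N A Ω t : ℝ) : ℂ)

/-- The Mellin zeta function `ζ^𝔐_{A,Ω}(s) = ∫_0^∞ t^{s-N-1}|A_t ∩ Ω| dt`. -/
def mellinZeta (N : ℕ) (A Ω : Set (EuclideanSpace ℝ (Fin N))) (s : ℂ) : ℂ :=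
  ∫ t in Set.Ioi (0 : ℝ), (t : ℂ) ^ (s - (N : ℂ) - 1) * ((tubeVol N A Ω t : ℝ) : ℂ)

/-- `(A,Ω)` is Minkowski measurable with dimension `D` and Minkowski content `M`. -/
def MinkMeasurable (N : ℕ) (A Ω : Set (EuclideanSpace ℝ (Fin N))) (D M : ℝ) : Prop :=
  0 < M ∧
    Tendsto (fun t : ℝ => tubeVol N A Ω t / t ^ ((N : ℝ) - D))
      (nhdsWithin 0 (Set.Ioi 0)) (nhds M)

/-- `ω` is a pole of `F` (the norm of `F` blows up at `ω`). -/
def IsPoleAt (F : ℂ → ℂ) (ω : ℂ) : Prop :=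
  Tendsto (fun s => ‖F s‖) (nhdsWithin ω {ω}ᶜ) atTop

/-- The languidity conditions **L1**–**L2** for `F` with screen `S`, exponent `κ`,
constants `c`, `C` and two-sided sequence `T`. -/
def LanguidWith (F : ℂ → ℂ) (S : ℝ → ℝ) (κ c C : ℝ) (T : ℤ → ℝ) : Prop :=
  0 < C ∧
  (∀ n : ℤ, 1 ≤ n → T (-n) < 0 ∧ 0 < T n) ∧
  Tendsto (fun n : ℕ => T (n : ℤ)) atTop atTop ∧
  Tendsto (fun n : ℕ => T (-(n : ℤ))) atTop atBot ∧
  (∀ n : ℤ, ∀ σ : ℝ, S (T n) < σ → σ < c →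
    ‖F ((σ : ℂ) + (T n : ℝ) * Complex.I)‖ ≤ C * (|T n| + 1) ^ κ) ∧
  (∀ τ : ℝ, 1 ≤ |τ| → ‖F ((S τ : ℂ) + (τ : ℝ) * Complex.I)‖ ≤ C * |τ| ^ κ)

/-- `S` is a screen (for upper box dimension `D`): a Lipschitz function bounded below,
with `sup S ≤ D`. -/
def IsScreen (S : ℝ → ℝ) (D : ℝ) : Prop :=
  (∃ K : NNReal, LipschitzWith K S) ∧ BddBelow (Set.range S) ∧ ∀ τ : ℝ, S τ ≤ D

/-- The window associated with the screen `S`. -/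
def window (S : ℝ → ℝ) : Set ℂ :=
  {s : ℂ | S s.im ≤ s.re}

/-- The Fejér kernel `sinc² (v/2)`, whose Fourier transform is supported in `[-1, 1]`. -/
def fejer (v : ℝ) : ℝ := Real.sinc (v / 2) ^ 2

lemma fejer_nonneg (v : ℝ) : 0 ≤ fejer v := sq_nonneg _

lemma continuous_fejer : Continuous fejer := by
  unfold fejer
  exact (Real.continuous_sinc.comp (by fun_prop)).pow 2

lemma fejer_zero : fejer 0 = 1 := by simp [fejer]

lemma fejer_eq {v : ℝ} (hv : v ≠ 0) : fejer v = 2 * (1 - Real.cos v) / v ^ 2 := by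
  have h : Real.cos v = 1 - 2 * Real.sin (v / 2) ^ 2 := by
    have := Real.cos_two_mul (v / 2)
    have h2 := Real.sin_sq_add_cos_sq (v / 2)
    rw [show 2 * (v / 2) = v by ring] at this
    linarith
  rw [fejer, Real.sinc_of_ne_zero (by positivity), h]
  field_simp
  ring

lemma fejer_le (v : ℝ) : fejer v ≤ 5 * (1 + v ^ 2)⁻¹ := by
  have h1 : fejer v ≤ 1 := by
    have := Real.abs_sinc_le_one (v / 2)
    rw [fejer, ← sq_abs]
    exact pow_le_one₀ (abs_nonneg _) this
  have h2 : v ^ 2 * fejer v ≤ 4 := by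
    rcases eq_or_ne v 0 with rfl | hv
    · simp
    · rw [fejer_eq hv]
      have := Real.neg_one_le_cos v
      have hv2 : v ^ 2 ≠ 0 := by positivity
      field_simp
      linarith
  rw [← div_eq_mul_inv, le_div_iff₀ (by positivity)]
  linarith

lemma integrable_fejer : Integrable fejer := by
  refine (integrable_inv_one_add_sq.const_mul 5).mono' continuous_fejer.aestronglyMeasurable ?_
  filter_upwards with v
  rw [Real.norm_of_nonneg (fejer_nonneg v)]
  exact fejer_le v

lemma integral_fejer_pos : 0 < ∫ v, fejer v :=
  integral_pos_of_integrable_nonneg_nonzero (x := 0) continuous_fejer integrable_fejer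
    fejer_nonneg (by simp [fejer_zero])

lemma integral_one_sub_mul_exp {v : ℝ} (hv : v ≠ 0) :
    ∫ τ in (0 : ℝ)..1, ((1 - τ : ℝ) : ℂ) * cexp (I * τ * v) =
      (1 - cexp (I * v)) / v ^ 2 - 1 / (I * v) := by
  have hv' : (v : ℂ) ≠ 0 := by exact_mod_cast hv
  have key : ∀ τ ∈ uIcc (0 : ℝ) 1, HasDerivAt
      (fun τ : ℝ => ((1 - τ : ℝ) : ℂ) * (cexp (I * τ * v) / (I * v)) - cexp (I * τ * v) / v ^ 2)
      (((1 - τ : ℝ) : ℂ) * cexp (I * τ * v)) τ := by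
    intro τ _
    have h0 : HasDerivAt (fun τ : ℝ => ((τ : ℝ) : ℂ)) 1 τ := Complex.ofRealCLM.hasDerivAt
    have h1 : HasDerivAt (fun τ : ℝ => ((1 - τ : ℝ) : ℂ)) (-1) τ := by
      simpa using h0.const_sub 1
    have h2 : HasDerivAt (fun τ : ℝ => cexp (I * τ * v)) (cexp (I * τ * v) * (I * v)) τ := by
      have := ((h0.const_mul I).mul_const (v : ℂ)).cexp
      simpa using this
    have h3 := (h1.mul (h2.div_const (I * v))).sub (h2.div_const ((v : ℂ) ^ 2))
    refine h3.congr_deriv ?_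
    field_simp
    ring_nf
    rw [I_sq]
    ring
  rw [intervalIntegral.integral_eq_sub_of_hasDerivAt key
    (Continuous.intervalIntegrable (by fun_prop) _ _)]
  simp
  field_simp
  ring

/-- The Fourier transform of the triangle function is the Fejér kernel. -/
lemma integral_triangle_mul_exp (v : ℝ) :
    ∫ τ in (-1 : ℝ)..1, ((1 - |τ| : ℝ) : ℂ) * cexp (I * τ * v) = fejer v := by
  have hc : ∀ a b : ℝ, IntervalIntegrable
      (fun τ : ℝ => ((1 - |τ| : ℝ) : ℂ) * cexp (I * τ * v)) volume a b := fun a b =>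
    Continuous.intervalIntegrable (by fun_prop) _ _
  rw [← intervalIntegral.integral_add_adjacent_intervals (hc (-1) 0) (hc 0 1)]
  have e1 : ∀ w : ℝ, ∫ τ in (0 : ℝ)..1, ((1 - |τ| : ℝ) : ℂ) * cexp (I * τ * w) =
      ∫ τ in (0 : ℝ)..1, ((1 - τ : ℝ) : ℂ) * cexp (I * τ * w) := by
    intro w
    refine intervalIntegral.integral_congr fun τ hτ => ?_
    rw [uIcc_of_le zero_le_one] at hτ
    simp only [abs_of_nonneg hτ.1]
  have e2 : ∫ τ in (-1 : ℝ)..0, ((1 - |τ| : ℝ) : ℂ) * cexp (I * τ * v) =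
      ∫ τ in (0 : ℝ)..1, ((1 - |τ| : ℝ) : ℂ) * cexp (I * τ * (-v : ℝ)) := by
    have := intervalIntegral.integral_comp_neg (a := 0) (b := 1)
      (fun τ : ℝ => ((1 - |τ| : ℝ) : ℂ) * cexp (I * τ * v))
    simp only [neg_zero] at this
    rw [← this]
    refine intervalIntegral.integral_congr fun τ _ => ?_
    simp
  rw [e2, e1, e1]
  rcases eq_or_ne v 0 with rfl | hv
  · have : ∫ τ in (0 : ℝ)..1, ((1 - τ : ℝ) : ℂ) = ((1 / 2 : ℝ) : ℂ) := by
      rw [intervalIntegral.integral_ofReal]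
      congr 1
      rw [intervalIntegral.integral_sub (by simp) (by simp)]
      simp
      norm_num
    simp only [fejer_zero, neg_zero, ofReal_zero, mul_zero, Complex.exp_zero, mul_one, this]
    push_cast
    norm_num
  · rw [integral_one_sub_mul_exp hv, integral_one_sub_mul_exp (neg_ne_zero.2 hv), fejer_eq hv]
    have hv' : (v : ℂ) ≠ 0 := by exact_mod_cast hv
    push_cast
    have h3 : Complex.cos v = (cexp (I * v) + cexp (I * -v)) / 2 := by
      rw [Complex.cos]
      ring_nf
    rw [h3]
    field_simp
    ring

/-- The Laplace transform on a vertical line, integrated against the triangle function. -/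
lemma integral_triangle_mul_laplace {h : ℝ → ℝ} {ε : ℝ}
    (hint : IntegrableOn (fun x => h x * Real.exp (-ε * x)) (Ioi 0)) (l y : ℝ) :
    ∫ τ in (-1 : ℝ)..1, ((1 - |τ| : ℝ) : ℂ) * cexp (I * τ * (l * y : ℝ)) *
      (∫ x in Ioi (0 : ℝ), (h x : ℂ) * cexp (-(ε + l * τ * I) * x)) =
      ((∫ x in Ioi (0 : ℝ), h x * Real.exp (-ε * x) * fejer (l * y - l * x) : ℝ) : ℂ) := by
  rw [intervalIntegral.integral_of_le (by norm_num)]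
  simp_rw [← integral_const_mul]
  rw [integral_integral_swap]
  · rw [← integral_complex_ofReal]
    refine integral_congr_ae (ae_of_all _ fun x => ?_)
    beta_reduce
    rw [← intervalIntegral.integral_of_le (by norm_num)]
    push_cast [← integral_triangle_mul_exp]
    rw [← intervalIntegral.integral_const_mul]
    refine intervalIntegral.integral_congr fun τ _ => ?_
    have : cexp (I * τ * (l * y - l * x)) * cexp (-ε * x) =
        cexp (I * τ * (l * y)) * cexp (-(ε + l * τ * I) * x) := by
      rw [← Complex.exp_add, ← Complex.exp_add]
      ring_nf
    linear_combination -((1 - |τ| : ℂ) * h x) * this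
  · have h0 : IntegrableOn (fun τ : ℝ => ((1 - |τ| : ℝ) : ℂ)) (Ioc (-1) 1) :=
      Continuous.integrableOn_Ioc (by fun_prop)
    have h1 := Integrable.mul_prod (f := fun τ : ℝ => ((1 - |τ| : ℝ) : ℂ)) h0 (hint.ofReal (𝕜 := ℂ))
    have h2 : Continuous fun p : ℝ × ℝ => cexp ((p.1 * (l * y - l * p.2) : ℝ) * I) := by fun_prop
    refine (h1.bdd_mul h2.aestronglyMeasurable (c := 1) (ae_of_all _ fun p => ?_)).congr
      (ae_of_all _ fun p => ?_)
    · rw [Complex.norm_exp_ofReal_mul_I]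
    · simp only [Function.uncurry]
      have e : cexp ((p.1 * (l * y - l * p.2) : ℝ) * I) * ((Real.exp (-ε * p.2) : ℝ) : ℂ) =
          cexp (I * p.1 * (l * y : ℝ)) * cexp (-(ε + l * p.1 * I) * p.2) := by
        rw [ofReal_exp, ← Complex.exp_add, ← Complex.exp_add]
        push_cast
        ring_nf
      have e' : ((h p.2 * Real.exp (-ε * p.2) : ℝ) : ℂ) =
          (h p.2 : ℂ) * ((Real.exp (-ε * p.2) : ℝ) : ℂ) := ofReal_mul _ _
      change _ * (_ * ((h p.2 * Real.exp (-ε * p.2) : ℝ) : ℂ)) = _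
      rw [e']
      linear_combination (((1 - |p.1| : ℝ) : ℂ) * h p.2) * e

lemma window_le_integral_mul {f k : ℝ → ℝ} {A B p q : ℝ} (hp : 0 < p) (hk : ∀ x, 0 ≤ k x)
    (hki : Integrable k) (hfk : IntegrableOn (fun x => f x * k x) (Ioi 0)) (hB0 : 0 ≤ B)
    (hB : ∀ x, 0 < x → -B ≤ f x) (hA : ∀ x ∈ Icc p q, A ≤ f x) :
    (A + B) * (∫ x in Icc p q, k x) - B * ∫ x, k x ≤ ∫ x in Ioi (0 : ℝ), f x * k x := by
  have hsub : Icc p q ⊆ Ioi 0 := fun x hx => hp.trans_le hx.1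
  have hi : Integrable ((Icc p q).indicator k) := hki.indicator measurableSet_Icc
  have h1 : ∫ x in Icc p q, k x = ∫ x in Ioi (0 : ℝ), (Icc p q).indicator k x := by
    rw [setIntegral_indicator measurableSet_Icc, inter_eq_right.2 hsub]
  have h2 : ∫ x in Ioi (0 : ℝ), k x ≤ ∫ x, k x :=
    setIntegral_le_integral hki (ae_of_all _ hk)
  calc (A + B) * (∫ x in Icc p q, k x) - B * ∫ x, k x
      ≤ (A + B) * (∫ x in Ioi (0 : ℝ), (Icc p q).indicator k x) -
          B * ∫ x in Ioi (0 : ℝ), k x := by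
        rw [h1]
        gcongr
    _ = ∫ x in Ioi (0 : ℝ), ((A + B) * (Icc p q).indicator k x - B * k x) := by
        rw [integral_sub (hi.integrableOn.const_mul _) (hki.integrableOn.const_mul _),
          integral_const_mul, integral_const_mul]
    _ ≤ _ := by
        refine setIntegral_mono_on ((hi.integrableOn.const_mul _).sub
          (hki.integrableOn.const_mul _)) hfk measurableSet_Ioi fun x hx => ?_
        by_cases hxi : x ∈ Icc p q
        · rw [indicator_of_mem hxi]
          nlinarith [mul_le_mul_of_nonneg_right (hA x hxi) (hk x)]
        · rw [indicator_of_notMem hxi]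
          nlinarith [mul_le_mul_of_nonneg_right (hB x hx) (hk x)]

lemma integrable_fejer_comp {l : ℝ} (hl : 0 < l) (y : ℝ) :
    Integrable fun x => fejer (l * y - l * x) := by
  have := (integrable_fejer.comp_sub_left (l * y)).comp_mul_left' hl.ne'
  exact this

lemma integral_fejer_comp {l : ℝ} (hl : 0 < l) (y : ℝ) :
    ∫ x, fejer (l * y - l * x) = l⁻¹ * ∫ v, fejer v := by
  rw [Measure.integral_comp_mul_left (fun x => fejer (l * y - x)), integral_sub_left_eq_self,
    abs_of_pos (inv_pos.2 hl), smul_eq_mul]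

lemma setIntegral_fejer_comp {l η : ℝ} (hl : 0 < l) (hη : 0 ≤ η) (y : ℝ) :
    ∫ x in Icc (y - η) (y + η), fejer (l * y - l * x) =
      l⁻¹ * ∫ v in (-(l * η))..(l * η), fejer v := by
  rw [integral_Icc_eq_integral_Ioc, ← intervalIntegral.integral_of_le (by linarith),
    intervalIntegral.integral_comp_sub_mul _ hl.ne', smul_eq_mul]
  ring_nf

lemma laplace_sub_const {g : ℝ → ℝ} {c : ℝ}
    (hint : ∀ ε > 0, IntegrableOn (fun x => g x * Real.exp (-ε * x)) (Ioi 0)) {z : ℂ}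
    (hz : 0 < z.re) :
    ∫ x in Ioi (0 : ℝ), ((g x - c : ℝ) : ℂ) * cexp (-z * x) =
      (∫ x in Ioi (0 : ℝ), (g x : ℂ) * cexp (-z * x)) - c / z := by
  have hz0 : z ≠ 0 := by rintro rfl; simp at hz
  have h1 : IntegrableOn (fun x : ℝ => cexp (-z * x)) (Ioi 0) :=
    integrableOn_exp_mul_complex_Ioi (by simpa using hz) 0
  have h2 : IntegrableOn (fun x : ℝ => (g x : ℂ) * cexp (-z * x)) (Ioi 0) := by
    have hc : Continuous fun x : ℝ => cexp ((-z.im * x : ℝ) * I) := by fun_prop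
    refine (((hint _ hz).ofReal (𝕜 := ℂ)).bdd_mul hc.aestronglyMeasurable (c := 1)
      (ae_of_all _ fun x => (Complex.norm_exp_ofReal_mul_I _).le)).congr (ae_of_all _ fun x => ?_)
    have e' : ((g x * Real.exp (-z.re * x) : ℝ) : ℂ) =
        (g x : ℂ) * ((Real.exp (-z.re * x) : ℝ) : ℂ) := ofReal_mul _ _
    change _ * ((g x * Real.exp (-z.re * x) : ℝ) : ℂ) = _
    rw [e', ofReal_exp, mul_left_comm, ← Complex.exp_add]
    congr 2
    conv_rhs => rw [← re_add_im z]
    push_cast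
    ring
  have h3 : ∀ x : ℝ, ((g x - c : ℝ) : ℂ) * cexp (-z * x) =
      (g x : ℂ) * cexp (-z * x) - c * cexp (-z * x) := by
    intro x
    push_cast
    ring
  simp_rw [h3]
  rw [integral_sub h2 (h1.const_mul _), integral_const_mul,
    integral_exp_mul_complex_Ioi (by simpa using hz)]
  simp
  field_simp

lemma continuousAt_laplace {h : ℝ → ℝ}
    (hint : ∀ ε > 0, IntegrableOn (fun x => h x * Real.exp (-ε * x)) (Ioi 0)) {z : ℂ}
    (hz : 0 < z.re) :
    ContinuousAt (fun z => ∫ x in Ioi (0 : ℝ), (h x : ℂ) * cexp (-z * x)) z := by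
  have hm : AEStronglyMeasurable h (volume.restrict (Ioi 0)) := by
    have hc : Continuous fun x : ℝ => Real.exp (1 * x) := by fun_prop
    refine ((hint 1 one_pos).aestronglyMeasurable.mul hc.aestronglyMeasurable).congr
      (ae_of_all _ fun x => ?_)
    simp [mul_assoc, ← Real.exp_add]
  refine continuousAt_of_dominated (bound := fun x => ‖h x * Real.exp (-(z.re / 2) * x)‖) ?_ ?_
    (hint _ (by linarith)).norm ?_
  · filter_upwards with w
    have hc : Continuous fun x : ℝ => cexp (-w * x) := by fun_prop
    exact (continuous_ofReal.comp_aestronglyMeasurable hm).mul hc.aestronglyMeasurable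
  · have : ∀ᶠ w : ℂ in 𝓝 z, z.re / 2 < w.re :=
      continuous_re.continuousAt.eventually_const_lt (by linarith)
    filter_upwards [this] with w hw
    rw [ae_restrict_iff' measurableSet_Ioi]
    filter_upwards with x hx
    have hx : 0 < x := hx
    rw [norm_mul, norm_mul, Complex.norm_exp, Complex.norm_real, Real.norm_eq_abs (Real.exp _),
      abs_of_pos (Real.exp_pos _)]
    simp
    gcongr
  · exact ae_of_all _ fun x => by fun_prop

lemma exists_continuousOn_extension {P : ℂ → ℂ}
    (hP : ∀ z : ℂ, 0 < z.re → ContinuousAt P z)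
    (hlim : ∀ τ : ℝ, ∃ L, Tendsto P (𝓝[{z : ℂ | 0 < z.re}] (τ * I)) (𝓝 L)) :
    ∃ H : ℂ → ℂ, ContinuousOn H {z : ℂ | 0 ≤ z.re} ∧ ∀ z : ℂ, 0 < z.re → H z = P z := by
  refine ⟨extendFrom {z : ℂ | 0 < z.re} P, continuousOn_extendFrom ?_ ?_, ?_⟩
  · rw [Complex.closure_setOfPred_lt_re]
  · intro z hz
    rcases (show 0 ≤ z.re from hz).eq_or_lt with h | h
    · have : z = (z.im : ℂ) * I := by
        apply Complex.ext <;> simp [← h]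
      rw [this]
      exact hlim _
    · exact ⟨_, (hP z h).tendsto.mono_left nhdsWithin_le_nhds⟩
  · intro z hz
    exact extendFrom_eq (subset_closure hz) ((hP z hz).tendsto.mono_left nhdsWithin_le_nhds)

lemma tendsto_integral_triangle_mul_exp {f : ℝ → ℂ} {l : ℝ} (hl : 0 < l) :
    Tendsto (fun y : ℝ => ∫ τ in (-1 : ℝ)..1, ((1 - |τ| : ℝ) : ℂ) * cexp (I * τ * (l * y : ℝ)) * f τ)
      atTop (𝓝 0) := by
  have h1 := Real.tendsto_integral_exp_smul_cocompact
    ((Ioc (-1 : ℝ) 1).indicator fun τ => ((1 - |τ| : ℝ) : ℂ) * f τ)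
  have h2 : Tendsto (fun y : ℝ => (-(l / (2 * Real.pi))) * y) atTop (cocompact ℝ) :=
    (tendsto_id.const_mul_atTop_of_neg (by
      have := Real.pi_pos
      have : 0 < l / (2 * Real.pi) := by positivity
      linarith)).mono_right atBot_le_cocompact
  refine (h1.comp h2).congr fun y => ?_
  simp only [Function.comp]
  rw [intervalIntegral.integral_of_le (by norm_num), ← integral_indicator measurableSet_Ioc]
  refine integral_congr_ae (ae_of_all _ fun τ => ?_)
  simp only [indicator]
  split_ifs
  · rw [Circle.smul_def, Real.fourierChar_apply, smul_eq_mul]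
    have : cexp (((2 * Real.pi * -(τ * (-(l / (2 * Real.pi)) * y)) : ℝ) : ℂ) * I) =
        cexp (I * τ * (l * y : ℝ)) := by
      congr 1
      have : (Real.pi : ℂ) ≠ 0 := by exact_mod_cast Real.pi_ne_zero
      push_cast
      field_simp
    rw [this]
    ring
  · simp

/-- Smoothed means of `h` against the Fejér kernel, under continuity of the Laplace transform up
to the boundary: uniform boundedness, and convergence as the damping is removed. -/
lemma fejer_mean_tendsto {h : ℝ → ℝ}
    (hint : ∀ ε > 0, IntegrableOn (fun x => h x * Real.exp (-ε * x)) (Ioi 0))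
    (hlim : ∀ τ : ℝ, ∃ L, Tendsto (fun z : ℂ => ∫ x in Ioi (0 : ℝ), (h x : ℂ) * cexp (-z * x))
      (𝓝[{z : ℂ | 0 < z.re}] (τ * I)) (𝓝 L)) {l : ℝ} (hl : 0 < l) :
    (∃ B : ℝ, ∀ ε ∈ Ioc (0 : ℝ) 1, ∀ y,
      |∫ x in Ioi (0 : ℝ), h x * Real.exp (-ε * x) * fejer (l * y - l * x)| ≤ B) ∧
    ∃ R : ℝ → ℂ, Tendsto R atTop (𝓝 0) ∧ ∀ y, Tendsto
      (fun ε => ((∫ x in Ioi (0 : ℝ), h x * Real.exp (-ε * x) * fejer (l * y - l * x) : ℝ) : ℂ))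
      (𝓝[>] 0) (𝓝 (R y)) := by
  obtain ⟨H, hHc, hH⟩ := exists_continuousOn_extension (fun z hz => continuousAt_laplace hint hz) hlim
  have hHre : ∀ ε τ : ℝ, ((ε : ℂ) + l * τ * I).re = ε := by
    intro ε τ
    simp
  have hcomp : ContinuousOn (fun p : ℝ × ℝ => H ((p.1 : ℂ) + l * p.2 * I))
      (Icc 0 1 ×ˢ Icc (-1) 1) := by
    refine hHc.comp (Continuous.continuousOn (by fun_prop)) fun p hp => ?_
    rw [mem_ofPred_eq, hHre]
    exact hp.1.1
  obtain ⟨B, hB⟩ := (isCompact_Icc.prod isCompact_Icc).exists_bound_of_continuousOn hcomp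
  have hJ : ∀ ε > 0, ∀ y, ((∫ x in Ioi (0 : ℝ), h x * Real.exp (-ε * x) *
      fejer (l * y - l * x) : ℝ) : ℂ) = ∫ τ in (-1 : ℝ)..1,
        ((1 - |τ| : ℝ) : ℂ) * cexp (I * τ * (l * y : ℝ)) * H ((ε : ℂ) + l * τ * I) := by
    intro ε hε y
    rw [← integral_triangle_mul_laplace (hint ε hε)]
    refine intervalIntegral.integral_congr fun τ _ => ?_
    rw [hH _ (by rw [hHre]; exact hε)]
  have hbd : ∀ ε ∈ Icc (0 : ℝ) 1, ∀ y, ∀ τ ∈ uIoc (-1 : ℝ) 1,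
      ‖((1 - |τ| : ℝ) : ℂ) * cexp (I * τ * (l * y : ℝ)) * H ((ε : ℂ) + l * τ * I)‖ ≤ B := by
    intro ε hε y τ hτ
    rw [uIoc_of_le (by norm_num)] at hτ
    have h1 := hB (ε, τ) ⟨hε, hτ.1.le, hτ.2⟩
    have h2 : cexp (I * τ * (l * y : ℝ)) = cexp ((τ * (l * y) : ℝ) * I) := by
      congr 1
      push_cast
      ring
    have h3 : abs (1 - |τ|) ≤ 1 := by
      have : |τ| ≤ 1 := abs_le.2 ⟨hτ.1.le, hτ.2⟩
      rw [abs_of_nonneg (by linarith)]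
      linarith [abs_nonneg τ]
    rw [norm_mul, norm_mul, h2, Complex.norm_exp_ofReal_mul_I, Complex.norm_real, mul_one,
      Real.norm_eq_abs]
    calc _ ≤ 1 * B := by gcongr
      _ = B := one_mul B
  refine ⟨⟨B * |1 - (-1)|, fun ε hε y => ?_⟩, _, tendsto_integral_triangle_mul_exp
    (f := fun τ => H (l * τ * I)) hl, fun y => ?_⟩
  · rw [← Real.norm_eq_abs, ← Complex.norm_real, hJ ε hε.1]
    exact intervalIntegral.norm_integral_le_of_norm_le_const (hbd ε ⟨hε.1.le, hε.2⟩ y)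
  · have hev : ∀ᶠ ε : ℝ in 𝓝[>] 0, ε ∈ Ioc (0 : ℝ) 1 :=
      Ioc_mem_nhdsGT one_pos
    have hmeas : ∀ ε ∈ Icc (0 : ℝ) 1, ContinuousOn (fun τ : ℝ =>
        ((1 - |τ| : ℝ) : ℂ) * cexp (I * τ * (l * y : ℝ)) * H ((ε : ℂ) + l * τ * I))
        (Icc (-1) 1) := by
      intro ε hε
      refine ContinuousOn.mul (Continuous.continuousOn (by fun_prop)) ?_
      exact hcomp.comp (f := fun τ : ℝ => (ε, τ)) (Continuous.continuousOn (by fun_prop))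
        fun τ hτ => ⟨hε, hτ⟩
    refine Tendsto.congr' (f₁ := fun ε : ℝ => ∫ τ in (-1 : ℝ)..1,
        ((1 - |τ| : ℝ) : ℂ) * cexp (I * τ * (l * y : ℝ)) * H ((ε : ℂ) + l * τ * I)) ?_ ?_
    · filter_upwards [hev] with ε hε
      rw [hJ ε hε.1]
    · refine intervalIntegral.tendsto_integral_filter_of_dominated_convergence (fun _ => B) ?_ ?_
        (by simp) ?_
      · filter_upwards [hev] with ε hε
        rw [uIoc_of_le (by norm_num)]
        exact ((hmeas ε ⟨hε.1.le, hε.2⟩).mono Ioc_subset_Icc_self).aestronglyMeasurable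
          measurableSet_Ioc
      · filter_upwards [hev] with ε hε
        exact ae_of_all _ (hbd ε ⟨hε.1.le, hε.2⟩ y)
      · refine ae_of_all _ fun τ hτ => ?_
        rw [uIoc_of_le (by norm_num)] at hτ
        refine Tendsto.const_mul _ ?_
        have h1 : ContinuousWithinAt H {z : ℂ | 0 ≤ z.re} (l * τ * I) := by
          refine hHc _ ?_
          simp
        refine h1.tendsto.comp (tendsto_nhdsWithin_iff.2 ⟨?_, ?_⟩)
        · have : Continuous fun ε : ℝ => (ε : ℂ) + l * τ * I := by fun_prop
          have := this.tendsto 0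
          simp only [ofReal_zero, zero_add] at this
          exact this.mono_left nhdsWithin_le_nhds
        · filter_upwards [hev] with ε hε
          rw [hHre]
          exact hε.1.le

lemma integral_fejer_interval_pos {R : ℝ} (hR : 0 < R) : 0 < ∫ v in (-R)..R, fejer v := by
  refine intervalIntegral.integral_pos (by linarith) continuous_fejer.continuousOn
    (fun v _ => fejer_nonneg v) ⟨0, ⟨by linarith, hR.le⟩, by simp [fejer_zero]⟩

lemma mul_exp_integrable_sub_const {g : ℝ → ℝ} (c : ℝ)
    (hint : ∀ ε > 0, IntegrableOn (fun x => g x * Real.exp (-ε * x)) (Ioi 0)) :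
    ∀ ε > 0, IntegrableOn (fun x => (g x - c) * Real.exp (-ε * x)) (Ioi 0) := by
  intro ε hε
  refine ((hint ε hε).sub ((exp_neg_integrableOn_Ioi 0 hε).const_mul c)).congr_fun (fun x _ => ?_)
    measurableSet_Ioi
  simp [sub_mul]

lemma bounded_of_fejer_mean_bounded {g : ℝ → ℝ} {a c B : ℝ} (hg0 : ∀ x, 0 ≤ g x) (ha : 0 ≤ a)
    (hgrow : ∀ x t, 0 ≤ x → 0 ≤ t → g (x + t) ≤ Real.exp (a * t) * g x)
    (hint : ∀ ε > 0, IntegrableOn (fun x => g x * Real.exp (-ε * x)) (Ioi 0))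
    (hB : ∀ ε ∈ Ioc (0 : ℝ) 1, ∀ y,
      |∫ x in Ioi (0 : ℝ), (g x - c) * Real.exp (-ε * x) * fejer (1 * y - 1 * x)| ≤ B) :
    ∃ M, ∀ x, 0 ≤ x → g x ≤ M := by
  set m := ∫ v in (-1 : ℝ)..1, fejer v with hm
  have hmpos : 0 < m := integral_fejer_interval_pos one_pos
  set K := ∫ v, fejer v with hK
  refine ⟨max (Real.exp (a * 2) * g 0) ((B + |c| * K) * Real.exp (2 * a + 1) / m), fun y hy => ?_⟩
  rcases le_or_gt y 2 with h2 | h2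
  · refine le_max_of_le_left ?_
    have := hgrow 0 y le_rfl hy
    rw [zero_add] at this
    refine this.trans ?_
    have := hg0 0
    gcongr
  · refine le_max_of_le_right ?_
    have hy0 : 0 < y := by linarith
    set ε := 1 / y with hε
    have hεpos : 0 < ε := by positivity
    have hε1 : ε ≤ 1 := by rw [hε, div_le_one hy0]; linarith
    have hεy : ε * y = 1 := by rw [hε]; field_simp
    set k : ℝ → ℝ := fun x => fejer (1 * (y - 1) - 1 * x) with hk
    have hk0 : ∀ x, 0 ≤ k x := fun x => fejer_nonneg _
    have hki : Integrable k := integrable_fejer_comp one_pos _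
    have hkb : ∀ x, ‖k x‖ ≤ 5 := by
      intro x
      rw [Real.norm_of_nonneg (hk0 x)]
      refine (fejer_le _).trans ?_
      have : (1 + (1 * (y - 1) - 1 * x) ^ 2)⁻¹ ≤ 1 := inv_le_one_of_one_le₀ (by nlinarith)
      linarith
    have hint1 : IntegrableOn (fun x => g x * Real.exp (-ε * x) * k x) (Ioi 0) :=
      (hint ε hεpos).mul_bdd hki.aestronglyMeasurable.restrict (ae_of_all _ hkb)
    have hint2 : IntegrableOn (fun x => (g x - c) * Real.exp (-ε * x) * k x) (Ioi 0) :=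
      (mul_exp_integrable_sub_const c hint ε hεpos).mul_bdd
        hki.aestronglyMeasurable.restrict (ae_of_all _ hkb)
    have hw := window_le_integral_mul (f := fun x => g x * Real.exp (-ε * x)) (k := k)
      (A := Real.exp (-(2 * a + 1)) * g y) (B := 0) (p := y - 1 - 1) (q := y - 1 + 1)
      (by linarith) hk0 hki hint1 le_rfl
      (fun x _ => by have := hg0 x; simp; positivity) (by
        intro x hx
        have h3 := hgrow x (y - x) (by linarith [hx.1]) (by linarith [hx.2])
        rw [add_sub_cancel] at h3
        have h4 : Real.exp (a * (y - x)) ≤ Real.exp (2 * a) := by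
          apply Real.exp_le_exp.2
          nlinarith [hx.1]
        have h5 : Real.exp (-1) ≤ Real.exp (-ε * x) := by
          apply Real.exp_le_exp.2
          nlinarith [hx.2]
        have h6 : Real.exp (-(2 * a + 1)) = Real.exp (-1) * Real.exp (-(2 * a)) := by
          rw [← Real.exp_add]; ring_nf
        have h7 : Real.exp (-(2 * a)) * g y ≤ g x := by
          calc _ ≤ Real.exp (-(2 * a)) * (Real.exp (2 * a) * g x) := by
                have := hg0 x
                gcongr
                exact h3.trans (by gcongr)
            _ = g x := by rw [← mul_assoc, ← Real.exp_add]; simp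
        calc _ = Real.exp (-1) * (Real.exp (-(2 * a)) * g y) := by rw [h6]; ring
          _ ≤ Real.exp (-ε * x) * g x := by
              have := hg0 x
              have := hg0 y
              gcongr
          _ = _ := mul_comm _ _)
    rw [setIntegral_fejer_comp one_pos zero_le_one] at hw
    simp only [inv_one, one_mul, add_zero, zero_mul, sub_zero, mul_one] at hw
    rw [← hm] at hw
    have hle : ∫ x in Ioi (0 : ℝ), g x * Real.exp (-ε * x) * k x ≤
        (∫ x in Ioi (0 : ℝ), (g x - c) * Real.exp (-ε * x) * k x) +
          ∫ x in Ioi (0 : ℝ), |c| * k x := by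
      rw [← integral_add hint2 (hki.integrableOn.const_mul _)]
      refine setIntegral_mono_on hint1 (hint2.add (hki.integrableOn.const_mul _))
        measurableSet_Ioi fun x hx => ?_
      have hx : 0 < x := hx
      have h8 : Real.exp (-ε * x) ≤ 1 := Real.exp_le_one_iff.2 (by nlinarith)
      have h9 : c * Real.exp (-ε * x) ≤ |c| := by
        calc _ ≤ |c| * 1 := by
              gcongr
              exact le_abs_self c
          _ = |c| := mul_one _
      nlinarith [mul_le_mul_of_nonneg_right h9 (hk0 x)]
    have hle2 : ∫ x in Ioi (0 : ℝ), |c| * k x ≤ |c| * K := by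
      rw [integral_const_mul]
      gcongr
      refine (setIntegral_le_integral hki (ae_of_all _ hk0)).trans ?_
      rw [hk, integral_fejer_comp one_pos]
      simp [hK]
    have hle3 := (le_abs_self _).trans (hB ε ⟨hεpos, hε1⟩ (y - 1))
    have hfin : Real.exp (-(2 * a + 1)) * g y * m ≤ B + |c| * K := by
      linarith
    rw [le_div_iff₀ hmpos]
    calc g y * m = (Real.exp (-(2 * a + 1)) * g y * m) * Real.exp (2 * a + 1) := by
          rw [Real.exp_neg]; field_simp
      _ ≤ _ := by gcongr

lemma eventually_le_of_fejer_mean {f : ℝ → ℝ} {B e η : ℝ} (hB : ∀ x, 0 < x → |f x| ≤ B)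
    (hf : AEStronglyMeasurable f (volume.restrict (Ioi 0)))
    (hmean : ∀ l > 0, Tendsto (fun y => ∫ x in Ioi (0 : ℝ), f x * fejer (l * y - l * x))
      atTop (𝓝 0)) (hη : 0 < η) (he : 0 < e) :
    ∀ᶠ y in atTop, ∀ A, (∀ x ∈ Icc (y - η) (y + η), A ≤ f x) → A ≤ e := by
  have hB0 : 0 ≤ B := (abs_nonneg _).trans (hB 1 one_pos)
  set K := ∫ v, fejer v with hK
  have hKpos : 0 < K := integral_fejer_pos
  have hW : Tendsto (fun L : ℝ => ∫ v in (-L)..L, fejer v) atTop (𝓝 K) :=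
    intervalIntegral_tendsto_integral integrable_fejer tendsto_neg_atTop_atBot tendsto_id
  have hev : ∀ᶠ L : ℝ in atTop, B * (K - ∫ v in (-L)..L, fejer v) <
      e * (∫ v in (-L)..L, fejer v) / 2 := by
    refine Tendsto.eventually_lt ((hW.const_sub K).const_mul B) ((hW.const_mul e).div_const 2) ?_
    simp only [sub_self, mul_zero]
    positivity
  obtain ⟨L, hL, hLpos⟩ := (hev.and (eventually_gt_atTop 0)).exists
  set m := ∫ v in (-L)..L, fejer v with hm
  have hmpos : 0 < m := integral_fejer_interval_pos hLpos
  set l := L / η with hl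
  have hlpos : 0 < l := by positivity
  have hlη : l * η = L := by rw [hl]; field_simp
  have hJ : ∀ᶠ y in atTop, ∫ x in Ioi (0 : ℝ), f x * fejer (l * y - l * x) < l⁻¹ * (e * m / 2) :=
    (hmean l hlpos).eventually_lt_const (by positivity)
  filter_upwards [hJ, eventually_gt_atTop η] with y hy hyη A hA
  have hki := integrable_fejer_comp hlpos y
  have hw := window_le_integral_mul (f := f) (A := A) (p := y - η) (q := y + η)
    (by linarith) (fun x => fejer_nonneg _) hki
    (hki.integrableOn.bdd_mul hf ((ae_restrict_iff' measurableSet_Ioi).2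
      (ae_of_all _ fun x hx => hB x hx))) hB0 (fun x hx => (abs_le.1 (hB x hx)).1) hA
  rw [setIntegral_fejer_comp hlpos hη.le, integral_fejer_comp hlpos, hlη, ← hm, ← hK] at hw
  have h1 : l⁻¹ * ((A + B) * m - B * K) < l⁻¹ * (e * m / 2) := by
    refine lt_of_le_of_lt (le_of_eq ?_) (hw.trans_lt hy)
    ring
  have h2 := lt_of_mul_lt_mul_left h1 (by positivity)
  have h3 : A * m < e * m := by nlinarith
  exact (lt_of_mul_lt_mul_right h3 hmpos.le).le

/-- A Wiener–Ikehara Tauberian theorem: if `g ≥ 0` grows at most exponentially over every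
interval and its Laplace transform has, up to a simple pole at `0` of residue `c`, limits at every
point of the imaginary axis, then `g` tends to `c`. -/
theorem wiener_ikehara {g : ℝ → ℝ} {a c : ℝ} (hg0 : ∀ x, 0 ≤ g x) (ha : 0 ≤ a)
    (hgrow : ∀ x t, 0 ≤ x → 0 ≤ t → g (x + t) ≤ Real.exp (a * t) * g x)
    (hint : ∀ ε > 0, IntegrableOn (fun x => g x * Real.exp (-ε * x)) (Ioi 0))
    (hlim : ∀ τ : ℝ, ∃ L, Tendsto
      (fun z : ℂ => (∫ x in Ioi (0 : ℝ), (g x : ℂ) * cexp (-z * x)) - c / z)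
      (𝓝[{z : ℂ | 0 < z.re}] (τ * I)) (𝓝 L)) :
    Tendsto g atTop (𝓝 c) := by
  have hinth := mul_exp_integrable_sub_const c hint
  have hlimh : ∀ τ : ℝ, ∃ L, Tendsto
      (fun z : ℂ => ∫ x in Ioi (0 : ℝ), ((g x - c : ℝ) : ℂ) * cexp (-z * x))
      (𝓝[{z : ℂ | 0 < z.re}] (τ * I)) (𝓝 L) := by
    intro τ
    obtain ⟨L, hL⟩ := hlim τ
    refine ⟨L, hL.congr' ?_⟩
    filter_upwards [self_mem_nhdsWithin] with z hz
    rw [laplace_sub_const hint hz]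
  obtain ⟨⟨B, hB⟩, -⟩ := fejer_mean_tendsto hinth hlimh one_pos
  obtain ⟨M, hM⟩ := bounded_of_fejer_mean_bounded hg0 ha hgrow hint hB
  have hbd : ∀ x, 0 < x → |g x - c| ≤ M + |c| := fun x hx => by
    have h1 := hM x hx.le
    have h2 := hg0 x
    rw [abs_le]
    constructor <;> linarith [le_abs_self c, neg_abs_le c]
  have hmeas : AEStronglyMeasurable (fun x => g x - c) (volume.restrict (Ioi 0)) := by
    have hc : Continuous fun x : ℝ => Real.exp (1 * x) := by fun_prop
    refine ((hinth 1 one_pos).aestronglyMeasurable.mul hc.aestronglyMeasurable).congr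
      (ae_of_all _ fun x => ?_)
    simp [mul_assoc, ← Real.exp_add]
  have hmean : ∀ l > 0, Tendsto
      (fun y => ∫ x in Ioi (0 : ℝ), (g x - c) * fejer (l * y - l * x)) atTop (𝓝 0) := by
    intro l hl
    obtain ⟨-, R, hR, hRy⟩ := fejer_mean_tendsto hinth hlimh hl
    have hRe : ∀ y, R y = ((∫ x in Ioi (0 : ℝ), (g x - c) * fejer (l * y - l * x) : ℝ) : ℂ) := by
      intro y
      refine tendsto_nhds_unique (hRy y) ?_
      refine (continuous_ofReal.tendsto _).comp ?_
      have hki := integrable_fejer_comp hl y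
      refine tendsto_integral_filter_of_dominated_convergence
        (fun x => (M + |c|) * fejer (l * y - l * x)) ?_ ?_ (hki.integrableOn.const_mul _) ?_
      · filter_upwards with ε
        have hc : Continuous fun x : ℝ => Real.exp (-ε * x) := by fun_prop
        exact (hmeas.mul hc.aestronglyMeasurable).mul hki.aestronglyMeasurable.restrict
      · filter_upwards [self_mem_nhdsWithin] with ε hε
        rw [ae_restrict_iff' measurableSet_Ioi]
        refine ae_of_all _ fun x hx => ?_
        have hε : 0 < ε := hε
        have hx : 0 < x := hx
        have h8 : Real.exp (-ε * x) ≤ 1 := Real.exp_le_one_iff.2 (by nlinarith)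
        rw [norm_mul, norm_mul, Real.norm_of_nonneg (fejer_nonneg _),
          Real.norm_of_nonneg (Real.exp_pos _).le, Real.norm_eq_abs]
        have h9 := hbd x hx
        have h10 := fejer_nonneg (l * y - l * x)
        have h11 : 0 ≤ M + |c| := (abs_nonneg _).trans h9
        calc _ ≤ (M + |c|) * 1 * fejer (l * y - l * x) := by gcongr
          _ = _ := by ring
      · refine ae_of_all _ fun x => ?_
        have : Continuous fun ε : ℝ => (g x - c) * Real.exp (-ε * x) * fejer (l * y - l * x) := by
          fun_prop
        have := this.tendsto 0
        simp only [neg_zero, zero_mul, Real.exp_zero, mul_one] at this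
        exact this.mono_left nhdsWithin_le_nhds
    have := (continuous_re.tendsto 0).comp hR
    simpa [Function.comp_def, hRe] using this
  have hup : ∀ η > 0, ∀ᶠ y in atTop, g y ≤ Real.exp (2 * a * η) * (c + η) := by
    intro η hη
    have h := eventually_le_of_fejer_mean hbd hmeas hmean hη hη
    have h' := (tendsto_atTop_add_const_right atTop (-η) tendsto_id).eventually h
    filter_upwards [h', eventually_gt_atTop (2 * η)] with y hy hy2
    have h1 := hy (Real.exp (-(2 * a * η)) * g y - c) fun x hx => by
      simp only [id] at hx
      have h3 := hgrow x (y - x) (by linarith [hx.1]) (by linarith [hx.2])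
      rw [add_sub_cancel] at h3
      have h4 : Real.exp (a * (y - x)) ≤ Real.exp (2 * a * η) := by
        apply Real.exp_le_exp.2
        nlinarith [hx.1]
      have h5 : g y ≤ Real.exp (2 * a * η) * g x :=
        h3.trans (mul_le_mul_of_nonneg_right h4 (hg0 x))
      rw [Real.exp_neg, inv_mul_eq_div]
      gcongr
      rwa [div_le_iff₀' (Real.exp_pos _)]
    rw [Real.exp_neg, inv_mul_eq_div, sub_le_iff_le_add, div_le_iff₀' (Real.exp_pos _)] at h1
    linarith
  have hlow : ∀ η > 0, ∀ᶠ y in atTop, Real.exp (-(2 * a * η)) * (c - η) ≤ g y := by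
    intro η hη
    have h := eventually_le_of_fejer_mean (f := fun x => -(g x - c)) (B := M + |c|)
      (fun x hx => by rw [abs_neg]; exact hbd x hx) hmeas.neg
      (fun l hl => by
        have := (hmean l hl).neg
        simp only [neg_mul, integral_neg]
        simpa using this) hη hη
    have h' := (tendsto_atTop_add_const_right atTop η tendsto_id).eventually h
    filter_upwards [h', eventually_gt_atTop 0] with y hy hy2
    have h1 := hy (-(Real.exp (2 * a * η) * g y - c)) fun x hx => by
      simp only [id] at hx
      have h3 := hgrow y (x - y) hy2.le (by linarith [hx.1])
      rw [add_sub_cancel] at h3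
      have h4 : Real.exp (a * (x - y)) ≤ Real.exp (2 * a * η) := by
        apply Real.exp_le_exp.2
        nlinarith [hx.2]
      have h5 : g x ≤ Real.exp (2 * a * η) * g y :=
        h3.trans (mul_le_mul_of_nonneg_right h4 (hg0 y))
      linarith
    rw [Real.exp_neg, inv_mul_eq_div, div_le_iff₀' (Real.exp_pos _)]
    linarith
  rw [tendsto_order]
  constructor
  · intro b hb
    have h1 : Continuous fun η : ℝ => Real.exp (-(2 * a * η)) * (c - η) := by fun_prop
    have h2 := h1.tendsto 0
    simp only [mul_zero, neg_zero, Real.exp_zero, one_mul, sub_zero] at h2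
    obtain ⟨η, h3, h4⟩ := (((h2.mono_left nhdsWithin_le_nhds).eventually_const_lt hb).and
      (self_mem_nhdsWithin (s := Ioi (0 : ℝ)))).exists
    exact (hlow η h4).mono fun y hy => h3.trans_le hy
  · intro b hb
    have h1 : Continuous fun η : ℝ => Real.exp (2 * a * η) * (c + η) := by fun_prop
    have h2 := h1.tendsto 0
    simp only [mul_zero, Real.exp_zero, one_mul, add_zero] at h2
    obtain ⟨η, h3, h4⟩ := (((h2.mono_left nhdsWithin_le_nhds).eventually_lt_const hb).and
      (self_mem_nhdsWithin (s := Ioi (0 : ℝ)))).exists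
    exact (hup η h4).mono fun y hy => hy.trans_lt h3

section Tube

variable {N : ℕ} {A Ω : Set (EuclideanSpace ℝ (Fin N))}

lemma isOpen_nbhd (t : ℝ) : IsOpen (nbhd N A t) :=
  isOpen_lt (Metric.continuous_infDist_pt A) continuous_const

lemma nbhd_mono {t t' : ℝ} (h : t ≤ t') : nbhd N A t ⊆ nbhd N A t' :=
  fun _ hx => lt_of_lt_of_le hx h

lemma volume_nbhd_inter_ne_top (hΩ : volume Ω < ⊤) (t : ℝ) : volume (nbhd N A t ∩ Ω) ≠ ⊤ :=
  ((measure_mono inter_subset_right).trans_lt hΩ).ne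

lemma tubeVol_nonneg (t : ℝ) : 0 ≤ tubeVol N A Ω t := ENNReal.toReal_nonneg

lemma tubeVol_mono (hΩ : volume Ω < ⊤) : Monotone (tubeVol N A Ω) := fun _ _ h =>
  ENNReal.toReal_mono (volume_nbhd_inter_ne_top hΩ _)
    (measure_mono (inter_subset_inter_left _ (nbhd_mono h)))

lemma exists_tubeVol_le_rpow {D : ℝ} (hD : IsUpperMinkDim N A Ω D)
    {E : ℝ} (hE : D < E) :
    ∃ r < E, ∃ t₀ > 0, ∀ t ∈ Ioo 0 t₀, tubeVol N A Ω t ≤ t ^ ((N : ℝ) - r) := by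
  obtain ⟨r, hr, -, hrE⟩ := hD.exists_between hE
  have h1 : upperContent N A Ω r < 1 := by
    rw [show upperContent N A Ω r = 0 from hr]
    exact one_pos
  have h2 := eventually_lt_of_limsup_lt h1
  obtain ⟨t₀, ht₀, h3⟩ := mem_nhdsGT_iff_exists_Ioo_subset.1 h2
  refine ⟨r, hrE, t₀, ht₀, fun t ht => ?_⟩
  have h4 : volume (nbhd N A t ∩ Ω) / ENNReal.ofReal (t ^ ((N : ℝ) - r)) < 1 := h3 ht
  have h5 : 0 < t ^ ((N : ℝ) - r) := Real.rpow_pos_of_pos ht.1 _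
  have h6 : volume (nbhd N A t ∩ Ω) ≤ ENNReal.ofReal (t ^ ((N : ℝ) - r)) := by
    have := (ENNReal.div_le_iff (by simpa using h5) (by simp)).1 h4.le
    simpa using this
  exact ENNReal.toReal_le_of_le_ofReal h5.le h6

lemma volume_infDist_eq_zero {D : ℝ} (hΩ : volume Ω < ⊤) (hD : IsUpperMinkDim N A Ω D)
    (hDN : D < N) : volume ({x | Metric.infDist x A = 0} ∩ Ω) = 0 := by
  obtain ⟨r, hr, t₀, ht₀, h⟩ := exists_tubeVol_le_rpow hD hDN
  have hlim : Tendsto (fun t : ℝ => ENNReal.ofReal (t ^ ((N : ℝ) - r))) (𝓝[>] 0) (𝓝 0) := by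
    have h1 : Tendsto (fun t : ℝ => t ^ ((N : ℝ) - r)) (𝓝 0) (𝓝 0) := by
      have := (Real.continuousAt_rpow_const 0 ((N : ℝ) - r) (Or.inr (by linarith))).tendsto
      rwa [Real.zero_rpow (by linarith)] at this
    have := (ENNReal.continuous_ofReal.tendsto 0).comp (h1.mono_left (nhdsWithin_le_nhds (s := Ioi 0)))
    simpa [Function.comp_def] using this
  refine le_antisymm (ge_of_tendsto hlim ?_) zero_le
  filter_upwards [Ioo_mem_nhdsGT ht₀] with t ht
  have h2 : volume (nbhd N A t ∩ Ω) ≤ ENNReal.ofReal (t ^ ((N : ℝ) - r)) := by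
    rw [← ENNReal.ofReal_toReal (volume_nbhd_inter_ne_top hΩ t)]
    exact ENNReal.ofReal_le_ofReal (h t ht)
  refine (measure_mono (inter_subset_inter_left _ fun x hx => ?_)).trans h2
  change Metric.infDist x A < t
  rw [show Metric.infDist x A = 0 from hx]
  exact ht.1

/-- The tube function in the logarithmic variable. -/
def logTube (N : ℕ) (A Ω : Set (EuclideanSpace ℝ (Fin N))) (D δ : ℝ) (u : ℝ) : ℝ :=
  Real.exp (((N : ℝ) - D) * u) * tubeVol N A Ω (δ * Real.exp (-u))

lemma logTube_nonneg (D δ u : ℝ) : 0 ≤ logTube N A Ω D δ u :=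
  mul_nonneg (Real.exp_pos _).le (tubeVol_nonneg _)

lemma logTube_add_le (hΩ : volume Ω < ⊤) {D δ : ℝ} (hδ : 0 < δ) (x t : ℝ) (ht : 0 ≤ t) :
    logTube N A Ω D δ (x + t) ≤ Real.exp (((N : ℝ) - D) * t) * logTube N A Ω D δ x := by
  rw [logTube, logTube, ← mul_assoc, ← Real.exp_add,
    show ((N : ℝ) - D) * t + ((N : ℝ) - D) * x = ((N : ℝ) - D) * (x + t) by ring]
  gcongr
  apply tubeVol_mono hΩ
  gcongr
  linarith

lemma measurable_logTube (hΩ : volume Ω < ⊤) (D δ : ℝ) : Measurable (logTube N A Ω D δ) := by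
  have := (tubeVol_mono (N := N) (A := A) hΩ).measurable
  unfold logTube
  fun_prop

lemma integrableOn_logTube {D δ : ℝ} (hΩ : volume Ω < ⊤) (hD : IsUpperMinkDim N A Ω D)
    (hδ : 0 < δ) (ε : ℝ) (hε : 0 < ε) :
    IntegrableOn (fun u => logTube N A Ω D δ u * Real.exp (-ε * u)) (Ioi 0) := by
  obtain ⟨r, hr, t₀, ht₀, h⟩ := exists_tubeVol_le_rpow hD (show D < D + ε by linarith)
  have hκ : 0 < D + ε - r := by linarith
  have hlim : Tendsto (fun u : ℝ => δ * Real.exp (-u)) atTop (𝓝 0) := by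
    simpa using Real.tendsto_exp_neg_atTop_nhds_zero.const_mul δ
  obtain ⟨u₀, hu₀⟩ := eventually_atTop.1 (hlim.eventually_lt_const ht₀)
  have hmeas : Measurable fun u => logTube N A Ω D δ u * Real.exp (-ε * u) := by
    have := measurable_logTube (N := N) (A := A) hΩ D δ
    fun_prop
  have hsplit : Ioi (0 : ℝ) ⊆ Icc 0 (max u₀ 0) ∪ Ioi (max u₀ 0) := by
    intro x hx
    rcases le_or_gt x (max u₀ 0) with h1 | h1
    · exact Or.inl ⟨le_of_lt hx, h1⟩
    · exact Or.inr h1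
  refine IntegrableOn.mono_set (IntegrableOn.union ?_ ?_) hsplit
  · refine Measure.integrableOn_of_bounded (M := Real.exp (|(N : ℝ) - D| * max u₀ 0) * tubeVol N A Ω δ)
      (by simp) hmeas.aestronglyMeasurable ?_
    rw [ae_restrict_iff' measurableSet_Icc]
    refine ae_of_all _ fun u hu => ?_
    rw [norm_mul, Real.norm_of_nonneg (logTube_nonneg _ _ _), Real.norm_of_nonneg (Real.exp_pos _).le]
    have h8 : Real.exp (-ε * u) ≤ 1 := Real.exp_le_one_iff.2 (by nlinarith [hu.1])
    refine (mul_le_of_le_one_right (logTube_nonneg _ _ _) h8).trans ?_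
    unfold logTube
    gcongr
    · exact tubeVol_nonneg _
    · exact hu.1
    · exact le_abs_self _
    · exact hu.2
    · apply tubeVol_mono hΩ
      refine mul_le_of_le_one_right hδ.le (Real.exp_le_one_iff.2 ?_)
      linarith [hu.1]
  · refine ((exp_neg_integrableOn_Ioi (max u₀ 0) hκ).const_mul (δ ^ ((N : ℝ) - r))).mono'
      hmeas.aestronglyMeasurable ?_
    rw [ae_restrict_iff' measurableSet_Ioi]
    refine ae_of_all _ fun u hu => ?_
    rw [norm_mul, Real.norm_of_nonneg (logTube_nonneg _ _ _), Real.norm_of_nonneg (Real.exp_pos _).le]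
    have h1 := h (δ * Real.exp (-u)) ⟨by positivity, hu₀ u ((le_max_left _ _).trans (le_of_lt hu))⟩
    rw [Real.mul_rpow hδ.le (Real.exp_pos _).le, ← Real.exp_mul] at h1
    unfold logTube
    calc _ ≤ Real.exp (((N : ℝ) - D) * u) * (δ ^ ((N : ℝ) - r) * Real.exp (-u * ((N : ℝ) - r))) *
          Real.exp (-ε * u) := by gcongr
      _ = δ ^ ((N : ℝ) - r) * (Real.exp (((N : ℝ) - D) * u) * Real.exp (-u * ((N : ℝ) - r)) *
          Real.exp (-ε * u)) := by ring
      _ = _ := by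
        rw [← Real.exp_add, ← Real.exp_add]
        ring_nf

end Tube

section ZetaFormula

variable {N : ℕ} {A Ω : Set (EuclideanSpace ℝ (Fin N))}

lemma cpow_neg_eq_integral {d δ : ℝ} (hd : 0 < d) (hdδ : d < δ) (w : ℂ) :
    (d : ℂ) ^ (-w) = (δ : ℂ) ^ (-w) * (1 + w * ∫ u in Ioi (0 : ℝ),
      {u : ℝ | d < δ * Real.exp (-u)}.indicator (fun u : ℝ => cexp (w * u)) u) := by
  have hδ : 0 < δ := hd.trans hdδ
  set L := Real.log (δ / d) with hL
  have hL0 : 0 ≤ L := Real.log_nonneg (by rw [le_div_iff₀ hd]; linarith)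
  have hset : ∀ u : ℝ, d < δ * Real.exp (-u) ↔ u < L := by
    intro u
    rw [hL, Real.lt_log_iff_exp_lt (by positivity), lt_div_iff₀ hd, Real.exp_neg,
      ← div_eq_mul_inv, lt_div_iff₀ (Real.exp_pos _), mul_comm]
  have hm : MeasurableSet {u : ℝ | d < δ * Real.exp (-u)} :=
    measurableSet_lt measurable_const (by fun_prop)
  have hinter : Ioi (0 : ℝ) ∩ {u : ℝ | d < δ * Real.exp (-u)} = Ioo 0 L := by
    ext u
    exact and_congr_right fun _ => hset u
  have hint : w * ∫ u in Ioi (0 : ℝ), {u : ℝ | d < δ * Real.exp (-u)}.indicator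
      (fun u : ℝ => cexp (w * u)) u = cexp (w * L) - 1 := by
    rw [setIntegral_indicator hm, hinter, ← integral_Ioc_eq_integral_Ioo,
      ← intervalIntegral.integral_of_le hL0]
    rcases eq_or_ne w 0 with rfl | hw
    · simp
    · rw [integral_exp_mul_complex hw]
      simp
      field_simp
  have hd0 : (d : ℂ) ≠ 0 := by exact_mod_cast hd.ne'
  have hδ0 : (δ : ℂ) ≠ 0 := by exact_mod_cast hδ.ne'
  rw [hint, add_sub_cancel, cpow_def_of_ne_zero hd0, cpow_def_of_ne_zero hδ0, ← Complex.exp_add,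
    hL, Real.log_div hδ.ne' hd.ne', ofReal_sub, ofReal_log hd.le, ofReal_log hδ.le]
  ring_nf

/-- The distance zeta function in terms of the tube function. -/
lemma integral_infDist_cpow {δ : ℝ} (hδ : 0 < δ) (hΩm : MeasurableSet Ω) (hΩ : volume Ω < ⊤)
    (hnull : volume ({x | Metric.infDist x A = 0} ∩ Ω) = 0) (w : ℂ)
    (hint : IntegrableOn (fun u => Real.exp (w.re * u) * tubeVol N A Ω (δ * Real.exp (-u))) (Ioi 0)) :
    ∫ x in nbhd N A δ ∩ Ω, (Metric.infDist x A : ℂ) ^ (-w) =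
      (δ : ℂ) ^ (-w) * (tubeVol N A Ω δ + w * ∫ u in Ioi (0 : ℝ),
        (tubeVol N A Ω (δ * Real.exp (-u)) : ℂ) * cexp (w * u)) := by
  set X := nbhd N A δ ∩ Ω with hX
  have hXm : MeasurableSet X := (isOpen_nbhd δ).measurableSet.inter hΩm
  have : IsFiniteMeasure (volume.restrict X) :=
    ⟨by rw [Measure.restrict_apply_univ]; exact (volume_nbhd_inter_ne_top hΩ δ).lt_top⟩
  set Q : Set (EuclideanSpace ℝ (Fin N) × ℝ) := {p | Metric.infDist p.1 A < δ * Real.exp (-p.2)}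
    with hQ
  have hQm : MeasurableSet Q := by
    refine (isOpen_lt ?_ (by fun_prop)).measurableSet
    exact (Metric.continuous_infDist_pt A).comp continuous_fst
  set f : EuclideanSpace ℝ (Fin N) → ℝ → ℂ := fun x u =>
    Q.indicator (fun p => cexp (w * p.2)) (x, u) with hf
  have hvol : ∀ u, 0 < u → volume.real (nbhd N A (δ * Real.exp (-u)) ∩ X) =
      tubeVol N A Ω (δ * Real.exp (-u)) := by
    intro u hu
    have hle : δ * Real.exp (-u) ≤ δ :=
      mul_le_of_le_one_right hδ.le (Real.exp_le_one_iff.2 (by linarith))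
    rw [hX, ← inter_assoc, inter_eq_left.2 (nbhd_mono hle)]
    rfl
  have hslice : ∀ u, (fun x => f x u) =
      (nbhd N A (δ * Real.exp (-u))).indicator fun _ => cexp (w * u) := by
    intro u
    rfl
  have hnorm : ∀ u : ℝ, ‖cexp (w * u)‖ = Real.exp (w.re * u) := by
    intro u
    rw [Complex.norm_exp]
    simp
  have hnslice : ∀ u, (fun x => ‖f x u‖) =
      (nbhd N A (δ * Real.exp (-u))).indicator fun _ => Real.exp (w.re * u) := by
    intro u
    ext x
    rw [show f x u = (nbhd N A (δ * Real.exp (-u))).indicator (fun _ => cexp (w * u)) x from rfl,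
      norm_indicator_eq_indicator_norm, hnorm]
  have hsm : ∀ u, MeasurableSet (nbhd N A (δ * Real.exp (-u))) := fun u =>
    (isOpen_nbhd _).measurableSet
  have hInt : Integrable (Function.uncurry f)
      ((volume.restrict X).prod (volume.restrict (Ioi (0 : ℝ)))) := by
    have hfm : Measurable (Function.uncurry f) := by
      have h0 : Measurable fun p : EuclideanSpace ℝ (Fin N) × ℝ => cexp (w * p.2) := by fun_prop
      exact h0.indicator hQm
    rw [integrable_prod_iff' hfm.aestronglyMeasurable]
    refine ⟨ae_of_all _ fun u => ?_, ?_⟩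
    · change Integrable (fun x => f x u) _
      rw [hslice]
      exact (integrable_const _).indicator (hsm u)
    · refine hint.congr_fun (fun u hu => ?_) measurableSet_Ioi
      change _ = ∫ x, ‖f x u‖ ∂_
      rw [hnslice, integral_indicator (hsm u), Measure.restrict_restrict (hsm u),
        setIntegral_const, hvol u hu, smul_eq_mul, mul_comm]
  have hae : ∀ᵐ x ∂(volume.restrict X), (Metric.infDist x A : ℂ) ^ (-w) =
      (δ : ℂ) ^ (-w) * (1 + w * ∫ u in Ioi (0 : ℝ), f x u) := by
    have h0 : ∀ᵐ x ∂(volume : Measure (EuclideanSpace ℝ (Fin N))),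
        x ∉ {x | Metric.infDist x A = 0} ∩ Ω := measure_eq_zero_iff_ae_notMem.1 hnull
    rw [ae_restrict_iff' hXm]
    filter_upwards [h0] with x hx hxX
    have hd : 0 < Metric.infDist x A :=
      lt_of_le_of_ne Metric.infDist_nonneg fun h => hx ⟨h.symm, hxX.2⟩
    exact cpow_neg_eq_integral hd hxX.1 w
  have hI : Integrable (fun x => w * ∫ u in Ioi (0 : ℝ), f x u) (volume.restrict X) :=
    hInt.integral_prod_left.const_mul w
  rw [integral_congr_ae hae, integral_const_mul, integral_add (integrable_const _) hI,
    integral_const_mul, integral_integral_swap hInt]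
  congr 2
  · rw [setIntegral_const]
    simp [hX, tubeVol, Measure.real]
  · congr 1
    refine setIntegral_congr_fun measurableSet_Ioi fun u hu => ?_
    beta_reduce
    rw [hslice, integral_indicator (hsm u), Measure.restrict_restrict (hsm u),
      setIntegral_const, hvol u hu, real_smul]

lemma distZetaD_eq {D δ : ℝ} (hδ : 0 < δ) (hΩm : MeasurableSet Ω) (hΩ : volume Ω < ⊤)
    (hD : IsUpperMinkDim N A Ω D) (hDN : D < N) {z : ℂ} (hz : 0 < z.re) :
    distZetaD N A Ω δ (D + z) = (δ : ℂ) ^ (z - ((N : ℝ) - D : ℝ)) * (tubeVol N A Ω δ +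
      (((N : ℝ) - D : ℝ) - z) * ∫ u in Ioi (0 : ℝ), (logTube N A Ω D δ u : ℂ) * cexp (-z * u)) := by
  have h1 := integral_infDist_cpow hδ hΩm hΩ (volume_infDist_eq_zero hΩ hD hDN)
    (((N : ℝ) - D : ℝ) - z) (by
      refine (integrableOn_logTube hΩ hD hδ z.re hz).congr_fun (fun u _ => ?_) measurableSet_Ioi
      simp only [logTube, sub_re, ofReal_re]
      rw [mul_right_comm, ← Real.exp_add]
      ring_nf)
  rw [neg_sub] at h1
  rw [distZetaD]
  have e : (D : ℂ) + z - N = z - ((N : ℝ) - D : ℝ) := by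
    push_cast
    ring
  rw [e, h1]
  congr 3
  refine setIntegral_congr_fun measurableSet_Ioi fun u _ => ?_
  simp only [logTube]
  push_cast
  rw [mul_right_comm, ← Complex.exp_add, mul_comm]
  ring_nf

end ZetaFormula

section Poles

/-- A meromorphic function which has no pole at a point has a limit there. -/
lemma MeromorphicAt.exists_tendsto_of_not_isPoleAt {f : ℂ → ℂ} {ω : ℂ} (hf : MeromorphicAt f ω)
    (h : ¬ IsPoleAt f ω) : ∃ L, Tendsto f (𝓝[≠] ω) (𝓝 L) := by
  rw [tendsto_nhds_iff_meromorphicOrderAt_nonneg hf, ← not_lt,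
    ← tendsto_cobounded_iff_meromorphicOrderAt_neg hf, ← tendsto_norm_atTop_iff_cobounded]
  exact h

lemma not_isPoleAt_of_tendsto {f : ℂ → ℂ} {ω L : ℂ} (h : Tendsto f (𝓝[≠] ω) (𝓝 L)) :
    ¬ IsPoleAt f ω := fun h1 => not_tendsto_atTop_of_tendsto_nhds h.norm h1

/-- A meromorphic function with `(s - ω) f(s) → 0` has a removable singularity at `ω`. -/
lemma MeromorphicAt.exists_tendsto_of_sub_mul_tendsto_zero {f : ℂ → ℂ} {ω : ℂ}
    (hf : MeromorphicAt f ω) (h : Tendsto (fun s => (s - ω) * f s) (𝓝[≠] ω) (𝓝 0)) :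
    ∃ L, Tendsto f (𝓝[≠] ω) (𝓝 L) := by
  by_contra! h1
  have hpole : IsPoleAt f ω := by
    by_contra h2
    obtain ⟨L, hL⟩ := hf.exists_tendsto_of_not_isPoleAt h2
    exact h1 L hL
  obtain ⟨n, g, hg, hgω, hfg⟩ : ∃ n : ℕ, ∃ g : ℂ → ℂ, AnalyticAt ℂ g ω ∧ g ω ≠ 0 ∧
      ∀ᶠ s in 𝓝[≠] ω, (s - ω) ^ (n + 1) * f s = g s := by
    have hneg : meromorphicOrderAt f ω < 0 := by
      rw [← tendsto_cobounded_iff_meromorphicOrderAt_neg hf, ← tendsto_norm_atTop_iff_cobounded]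
      exact hpole
    obtain ⟨m, hm⟩ := WithTop.ne_top_iff_exists.1 hneg.ne_top
    obtain ⟨g, hg, hgω, hfg⟩ := (meromorphicOrderAt_eq_int_iff hf).1 hm.symm
    rw [← hm] at hneg
    have hm0 : m < 0 := by exact_mod_cast hneg
    obtain ⟨n, rfl⟩ : ∃ n : ℕ, m = -((n : ℤ) + 1) := ⟨(-m - 1).toNat, by omega⟩
    refine ⟨n, g, hg, hgω, ?_⟩
    filter_upwards [hfg, self_mem_nhdsWithin] with s hs hsω
    have : s - ω ≠ 0 := sub_ne_zero.2 hsω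
    rw [hs, smul_eq_mul, zpow_neg, ← mul_assoc, show (n : ℤ) + 1 = ((n + 1 : ℕ) : ℤ) by push_cast; rfl,
      zpow_natCast, mul_inv_cancel₀ (pow_ne_zero _ this), one_mul]
  have h3 : Tendsto (fun s => (s - ω) ^ n * ((s - ω) * f s)) (𝓝[≠] ω) (𝓝 ((ω - ω) ^ n * 0)) := by
    refine Tendsto.mul ?_ h
    exact ((by fun_prop : Continuous fun s => (s - ω) ^ n).tendsto ω).mono_left nhdsWithin_le_nhds
  rw [mul_zero] at h3
  have h4 : Tendsto (fun s => (s - ω) ^ n * ((s - ω) * f s)) (𝓝[≠] ω) (𝓝 (g ω)) := by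
    refine (hg.continuousAt.tendsto.mono_left nhdsWithin_le_nhds).congr' ?_
    filter_upwards [hfg] with s hs
    rw [← hs]
    ring
  exact hgω (tendsto_nhds_unique h4 h3)

/-- A meromorphic function with `(s - ω) f(s) → c` is `c / (s - ω)` up to a function with a
removable singularity. -/
lemma MeromorphicAt.exists_tendsto_sub_div {f : ℂ → ℂ} {ω c : ℂ} (hf : MeromorphicAt f ω)
    (h : Tendsto (fun s => (s - ω) * f s) (𝓝[≠] ω) (𝓝 c)) :
    ∃ L, Tendsto (fun s => f s - c / (s - ω)) (𝓝[≠] ω) (𝓝 L) := by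
  refine MeromorphicAt.exists_tendsto_of_sub_mul_tendsto_zero (by fun_prop) ?_
  rw [← sub_self c]
  refine (h.sub_const c).congr' ?_
  filter_upwards [self_mem_nhdsWithin] with s hs
  have : s - ω ≠ 0 := sub_ne_zero.2 hs
  field_simp

/-- The limit of a meromorphic function may be computed along a horizontal segment. -/
lemma MeromorphicAt.tendsto_of_tendsto_add_ofReal {f : ℂ → ℂ} {ω L : ℂ} (hf : MeromorphicAt f ω)
    (h : Tendsto (fun t : ℝ => f (ω + t)) (𝓝[>] 0) (𝓝 L)) : Tendsto f (𝓝[≠] ω) (𝓝 L) := by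
  have hpath : Tendsto (fun t : ℝ => ω + t) (𝓝[>] 0) (𝓝[≠] ω) := by
    refine tendsto_nhdsWithin_iff.2 ⟨?_, ?_⟩
    · have : Tendsto (fun t : ℝ => ω + t) (𝓝 0) (𝓝 (ω + (0 : ℝ))) :=
        (by fun_prop : Continuous fun t : ℝ => ω + t).tendsto 0
      simpa using this.mono_left nhdsWithin_le_nhds
    · filter_upwards [self_mem_nhdsWithin] with t ht
      have : t ≠ 0 := ne_of_gt ht
      simpa using this
  obtain ⟨L', hL'⟩ := hf.exists_tendsto_of_not_isPoleAt fun h1 =>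
    not_tendsto_atTop_of_tendsto_nhds h.norm (h1.comp hpath)
  rwa [tendsto_nhds_unique h (hL'.comp hpath)]

end Poles

section Abelian

lemma tendsto_mul_laplace_zero {h : ℝ → ℝ}
    (hint : ∀ ε > 0, IntegrableOn (fun u => h u * Real.exp (-ε * u)) (Ioi 0))
    (hlim : Tendsto h atTop (𝓝 0)) (τ : ℝ) :
    Tendsto (fun t : ℝ => (t : ℂ) * ∫ u in Ioi (0 : ℝ), (h u : ℂ) * cexp (-(t + τ * I) * u))
      (𝓝[>] 0) (𝓝 0) := by
  rw [Metric.tendsto_nhds]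
  intro ε hε
  obtain ⟨X, hX⟩ := eventually_atTop.1 (Metric.tendsto_nhds.1 hlim (ε / 2) (by positivity))
  set K := ∫ u in Ioi (0 : ℝ), |h u * Real.exp (-1 * u)| with hK
  have hsmall : ∀ᶠ t : ℝ in 𝓝[>] 0, t * (Real.exp X * K) < ε / 2 := by
    have h1 : Tendsto (fun t : ℝ => t * (Real.exp X * K)) (𝓝 0) (𝓝 (0 * (Real.exp X * K))) :=
      (by fun_prop : Continuous fun t : ℝ => t * (Real.exp X * K)).tendsto 0
    rw [zero_mul] at h1
    exact (h1.mono_left nhdsWithin_le_nhds).eventually_lt_const (by positivity)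
  filter_upwards [hsmall, self_mem_nhdsWithin] with t ht ht0
  have ht0 : 0 < t := ht0
  have hexp : IntegrableOn (fun u : ℝ => Real.exp (-t * u)) (Ioi 0) := exp_neg_integrableOn_Ioi 0 ht0
  have hexpint : ∫ u in Ioi (0 : ℝ), Real.exp (-t * u) = 1 / t := by
    rw [integral_exp_mul_Ioi (by linarith)]
    simp
  have hbound : ‖∫ u in Ioi (0 : ℝ), (h u : ℂ) * cexp (-(t + τ * I) * u)‖ ≤
      ∫ u in Ioi (0 : ℝ), (Real.exp X * |h u * Real.exp (-1 * u)| + ε / 2 * Real.exp (-t * u)) := by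
    refine norm_integral_le_of_norm_le
      (((hint 1 one_pos).abs.const_mul _).add (hexp.const_mul _)) ?_
    rw [ae_restrict_iff' measurableSet_Ioi]
    refine ae_of_all _ fun u hu => ?_
    have hu : 0 < u := hu
    rw [norm_mul, norm_real, Complex.norm_exp, Real.norm_eq_abs, abs_mul, Real.abs_exp]
    have hre : (-((t : ℂ) + τ * I) * u).re = -t * u := by simp
    rw [hre]
    rcases le_or_gt X u with h1 | h1
    · have h2 := hX u h1
      rw [Real.dist_eq, sub_zero] at h2
      have h3 : |h u| * Real.exp (-t * u) ≤ ε / 2 * Real.exp (-t * u) := by gcongr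
      have h4 : 0 ≤ Real.exp X * (|h u| * Real.exp (-1 * u)) := by positivity
      linarith
    · have h2 : Real.exp (-t * u) ≤ Real.exp X * Real.exp (-1 * u) := by
        rw [← Real.exp_add]
        refine Real.exp_le_exp.2 ?_
        nlinarith
      have h3 : |h u| * Real.exp (-t * u) ≤ |h u| * (Real.exp X * Real.exp (-1 * u)) := by gcongr
      have h4 : 0 ≤ ε / 2 * Real.exp (-t * u) := by positivity
      linarith
  rw [integral_add ((hint 1 one_pos).abs.const_mul _) (hexp.const_mul _), integral_const_mul,
    integral_const_mul, hexpint, ← hK] at hbound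
  rw [dist_zero_right, norm_mul, norm_real, Real.norm_of_nonneg ht0.le]
  calc _ ≤ t * (Real.exp X * K + ε / 2 * (1 / t)) := by gcongr
    _ = t * (Real.exp X * K) + ε / 2 := by field_simp
    _ < ε := by linarith

/-- The Abelian counterpart of the Wiener-Ikehara theorem, along horizontal lines. -/
lemma tendsto_mul_laplace {g : ℝ → ℝ} {c : ℝ}
    (hint : ∀ ε > 0, IntegrableOn (fun u => g u * Real.exp (-ε * u)) (Ioi 0))
    (hlim : Tendsto g atTop (𝓝 c)) (τ : ℝ) :
    Tendsto (fun t : ℝ => (t : ℂ) * ∫ u in Ioi (0 : ℝ), (g u : ℂ) * cexp (-(t + τ * I) * u))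
      (𝓝[>] 0) (𝓝 (if τ = 0 then (c : ℂ) else 0)) := by
  have hexp : ∀ ε > 0, IntegrableOn (fun u : ℝ => c * Real.exp (-ε * u)) (Ioi 0) :=
    fun ε hε => (exp_neg_integrableOn_Ioi 0 hε).const_mul c
  have h1 : Tendsto (fun t : ℝ => (t : ℂ) *
      ∫ u in Ioi (0 : ℝ), ((g u - c : ℝ) : ℂ) * cexp (-(t + τ * I) * u)) (𝓝[>] 0) (𝓝 0) := by
    refine tendsto_mul_laplace_zero (h := fun u => g u - c) (fun ε hε => ?_) ?_ τ
    · simpa only [sub_mul, Pi.sub_def] using (hint ε hε).sub (hexp ε hε)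
    · simpa using hlim.sub_const c
  have h2 : Tendsto (fun t : ℝ => (c : ℂ) * (t / (t + τ * I))) (𝓝[>] 0)
      (𝓝 (if τ = 0 then (c : ℂ) else 0)) := by
    split_ifs with hτ
    · refine tendsto_const_nhds.congr' ?_
      filter_upwards [self_mem_nhdsWithin] with t ht
      have : (t : ℂ) ≠ 0 := by exact_mod_cast (ne_of_gt ht : t ≠ 0)
      simp [hτ, this]
    · have hc : ContinuousAt (fun t : ℝ => (c : ℂ) * (t / (t + τ * I))) 0 := by
        have : ((0 : ℝ) : ℂ) + τ * I ≠ 0 := by simpa using hτ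
        fun_prop (disch := assumption)
      simpa using hc.tendsto.mono_left nhdsWithin_le_nhds
  refine ((h1.add h2).congr' ?_).trans (by rw [zero_add])
  filter_upwards [self_mem_nhdsWithin] with t ht
  have hre : 0 < ((t : ℂ) + τ * I).re := by simpa using ht
  rw [laplace_sub_const hint hre]
  ring

end Abelian

/-- The residue at `0` of the Laplace transform of a nonnegative function is a nonnegative real
number. -/
lemma exists_ofReal_eq_of_tendsto_laplace_sub_div {g : ℝ → ℝ} {b : ℂ} (hg : ∀ u, 0 ≤ g u)
    (h : ∃ L, Tendsto (fun z : ℂ => (∫ u in Ioi (0 : ℝ), (g u : ℂ) * cexp (-z * u)) - b / z)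
      (𝓝[{z : ℂ | 0 < z.re}] 0) (𝓝 L)) : ∃ m : ℝ, 0 ≤ m ∧ (m : ℂ) = b := by
  obtain ⟨L, hL⟩ := h
  have hid : Tendsto (fun t : ℝ => (t : ℂ)) (𝓝[>] 0) (𝓝 0) := by
    have := (continuous_ofReal.tendsto 0).mono_left (nhdsWithin_le_nhds (s := Ioi (0 : ℝ)))
    rwa [ofReal_zero] at this
  have hpath : Tendsto (fun t : ℝ => (t : ℂ)) (𝓝[>] 0) (𝓝[{z : ℂ | 0 < z.re}] 0) := by
    refine tendsto_nhdsWithin_iff.2 ⟨hid, ?_⟩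
    filter_upwards [self_mem_nhdsWithin] with t ht
    exact ht
  have h1 : Tendsto (fun t : ℝ => ((t * ∫ u in Ioi (0 : ℝ), g u * Real.exp (-t * u) : ℝ) : ℂ))
      (𝓝[>] 0) (𝓝 b) := by
    have h2 := (hid.mul (hL.comp hpath)).add_const b
    rw [zero_mul, zero_add] at h2
    refine h2.congr' ?_
    filter_upwards [self_mem_nhdsWithin] with t ht
    have ht0 : (t : ℂ) ≠ 0 := ofReal_ne_zero.2 (ne_of_gt ht)
    rw [Function.comp_apply, mul_sub, mul_div_cancel₀ _ ht0, sub_add_cancel, ofReal_mul,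
      ← integral_complex_ofReal]
    congr 2
    ext u
    push_cast
    rfl
  have hclosed : IsClosed (((↑) : ℝ → ℂ) '' Ici 0) :=
    isometry_ofReal.isClosedEmbedding.isClosedMap _ isClosed_Ici
  refine hclosed.mem_of_tendsto h1 ?_
  filter_upwards [self_mem_nhdsWithin] with t ht
  have h3 : 0 ≤ t * ∫ u in Ioi (0 : ℝ), g u * Real.exp (-t * u) :=
    mul_nonneg (le_of_lt ht) (integral_nonneg fun u => mul_nonneg (hg u) (Real.exp_pos _).le)
  exact mem_image_of_mem _ h3

section Criterion

variable {N : ℕ} {A Ω : Set (EuclideanSpace ℝ (Fin N))} {D δ : ℝ}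

lemma logTube_log_div (hδ : 0 < δ) {t : ℝ} (ht : 0 < t) :
    logTube N A Ω D δ (Real.log (δ / t)) =
      δ ^ ((N : ℝ) - D) * (tubeVol N A Ω t / t ^ ((N : ℝ) - D)) := by
  have h1 : δ * Real.exp (-Real.log (δ / t)) = t := by
    rw [Real.exp_neg, Real.exp_log (by positivity)]
    field_simp
  rw [logTube, h1, mul_comm ((N : ℝ) - D), Real.exp_mul, Real.exp_log (by positivity),
    Real.div_rpow hδ.le ht.le]
  ring

lemma tendsto_tubeVol_div_of_tendsto_logTube (hδ : 0 < δ) {c : ℝ}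
    (h : Tendsto (logTube N A Ω D δ) atTop (𝓝 c)) :
    Tendsto (fun t : ℝ => tubeVol N A Ω t / t ^ ((N : ℝ) - D)) (𝓝[>] 0)
      (𝓝 (c / δ ^ ((N : ℝ) - D))) := by
  have h1 : Tendsto (fun t : ℝ => Real.log (δ / t)) (𝓝[>] 0) atTop :=
    Real.tendsto_log_atTop.comp (tendsto_inv_nhdsGT_zero.const_mul_atTop hδ)
  refine ((h.comp h1).div_const (δ ^ ((N : ℝ) - D))).congr' ?_
  filter_upwards [self_mem_nhdsWithin] with t ht
  have : δ ^ ((N : ℝ) - D) ≠ 0 := (Real.rpow_pos_of_pos hδ _).ne'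
  rw [Function.comp_apply, logTube_log_div hδ ht, mul_div_cancel_left₀ _ this]

lemma tendsto_logTube_of_tendsto_tubeVol_div (hδ : 0 < δ) {M : ℝ}
    (h : Tendsto (fun t : ℝ => tubeVol N A Ω t / t ^ ((N : ℝ) - D)) (𝓝[>] 0) (𝓝 M)) :
    Tendsto (logTube N A Ω D δ) atTop (𝓝 (δ ^ ((N : ℝ) - D) * M)) := by
  have h1 : Tendsto (fun u : ℝ => δ * Real.exp (-u)) atTop (𝓝[>] 0) := by
    refine tendsto_nhdsWithin_iff.2 ⟨?_, Eventually.of_forall fun u => ?_⟩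
    · simpa using Real.tendsto_exp_neg_atTop_nhds_zero.const_mul δ
    · exact mul_pos hδ (Real.exp_pos _)
  refine ((h.comp h1).const_mul (δ ^ ((N : ℝ) - D))).congr fun u => ?_
  rw [Function.comp_apply, ← logTube_log_div hδ (mul_pos hδ (Real.exp_pos _))]
  congr 1
  rw [div_mul_cancel_left₀ hδ.ne', ← Real.exp_neg, neg_neg, Real.log_exp]

/-- The singular behaviour of the distance zeta function of a Minkowski measurable relative
fractal drum on the critical line. -/
lemma tendsto_mul_distZetaD (hδ : 0 < δ) (hΩm : MeasurableSet Ω) (hΩ : volume Ω < ⊤)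
    (hD : IsUpperMinkDim N A Ω D) (hDN : D < N) {M : ℝ} (hM : MinkMeasurable N A Ω D M) (τ : ℝ) :
    Tendsto (fun t : ℝ => (t : ℂ) * distZetaD N A Ω δ (D + (t + τ * I))) (𝓝[>] 0)
      (𝓝 (if τ = 0 then ((((N : ℝ) - D) * M : ℝ) : ℂ) else 0)) := by
  have hδ0 : (δ : ℂ) ≠ 0 := by exact_mod_cast hδ.ne'
  have h1 := tendsto_mul_laplace (integrableOn_logTube hΩ hD hδ)
    (tendsto_logTube_of_tendsto_tubeVol_div hδ hM.2) τ
  have hid : Tendsto (fun t : ℝ => (t : ℂ)) (𝓝[>] 0) (𝓝 0) := by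
    have := (continuous_ofReal.tendsto 0).mono_left (nhdsWithin_le_nhds (s := Ioi (0 : ℝ)))
    rwa [ofReal_zero] at this
  have hz : Tendsto (fun t : ℝ => (t : ℂ) + τ * I) (𝓝[>] 0) (𝓝 (τ * I)) := by
    simpa using hid.add_const (τ * I)
  have hpow : Tendsto (fun t : ℝ => (δ : ℂ) ^ ((t : ℂ) + τ * I - ((N : ℝ) - D : ℝ))) (𝓝[>] 0)
      (𝓝 ((δ : ℂ) ^ (τ * I - ((N : ℝ) - D : ℝ)))) :=
    (hz.sub_const _).const_cpow (Or.inl hδ0)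
  have h2 := hpow.mul ((hid.mul_const (tubeVol N A Ω δ : ℂ)).add
    ((hz.const_sub (((N : ℝ) - D : ℝ) : ℂ)).mul h1))
  have hlim : (δ : ℂ) ^ (τ * I - ((N : ℝ) - D : ℝ)) * (0 * (tubeVol N A Ω δ : ℂ) +
      ((((N : ℝ) - D : ℝ) : ℂ) - τ * I) *
        (if τ = 0 then ((δ ^ ((N : ℝ) - D) * M : ℝ) : ℂ) else 0)) =
      if τ = 0 then ((((N : ℝ) - D) * M : ℝ) : ℂ) else 0 := by
    split_ifs with hτ
    · rw [hτ, ofReal_zero, zero_mul, zero_sub, sub_zero, zero_mul, zero_add, ofReal_mul (_ ^ _),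
        ofReal_cpow hδ.le, cpow_neg, ofReal_mul]
      have : (δ : ℂ) ^ (((N : ℝ) - D : ℝ) : ℂ) ≠ 0 := by simp [cpow_eq_zero_iff, hδ0]
      field_simp
    · simp
  rw [hlim] at h2
  refine h2.congr' ?_
  filter_upwards [self_mem_nhdsWithin] with t ht
  have hre : 0 < ((t : ℂ) + τ * I).re := by simpa using ht
  rw [distZetaD_eq hδ hΩm hΩ hD hDN hre]
  ring

/-- A meromorphic extension of the distance zeta function with at most a simple pole on the
critical line yields the boundary behaviour required by the Wiener-Ikehara theorem. -/
lemma exists_tendsto_laplace_logTube_sub_div (hδ : 0 < δ) (hΩm : MeasurableSet Ω)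
    (hΩ : volume Ω < ⊤) (hD : IsUpperMinkDim N A Ω D) (hDN : D < N) {F : ℂ → ℂ} {r : ℂ}
    (hF : ∀ s : ℂ, s.re = D → MeromorphicAt F s)
    (hFζ : ∀ s : ℂ, D < s.re → F s = distZetaD N A Ω δ s)
    (hr : Tendsto (fun s : ℂ => (s - D) * F s) (𝓝[≠] (D : ℂ)) (𝓝 r))
    (hpole : ∀ ω : ℂ, ω.re = D → IsPoleAt F ω → ω = D) (τ : ℝ) :
    ∃ L, Tendsto (fun z : ℂ => (∫ u in Ioi (0 : ℝ), (logTube N A Ω D δ u : ℂ) * cexp (-z * u)) -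
      ((δ : ℂ) ^ (((N : ℝ) - D : ℝ) : ℂ) * r / ((N : ℝ) - D : ℝ)) / z)
      (𝓝[{z : ℂ | 0 < z.re}] (τ * I)) (𝓝 L) := by
  set a : ℝ := (N : ℝ) - D with ha
  have ha0 : 0 < a := by linarith
  have hδ0 : (δ : ℂ) ≠ 0 := by exact_mod_cast hδ.ne'
  have haz : ∀ s : ℂ, s.re = D → (a : ℂ) - (s - D) ≠ 0 := by
    intro s hs h0
    have := congrArg re h0
    simp [hs] at this
    linarith
  set H : ℂ → ℂ := fun s => ((δ : ℂ) ^ ((a : ℂ) - (s - D)) * F s - tubeVol N A Ω δ) /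
    ((a : ℂ) - (s - D)) with hH
  have hpowA : Differentiable ℂ fun s : ℂ => (δ : ℂ) ^ ((a : ℂ) - (s - D)) := by
    intro s
    exact DifferentiableAt.const_cpow (by fun_prop) (Or.inl hδ0)
  have key : ∃ L, Tendsto (fun s => H s - ((δ : ℂ) ^ (a : ℂ) * r / a) / (s - D))
      (𝓝[≠] (D + τ * I)) (𝓝 L) := by
    rcases eq_or_ne τ 0 with rfl | hτ
    · simp only [ofReal_zero, zero_mul, add_zero]
      have hFm := hF D (ofReal_re D)
      have hpowM : MeromorphicAt (fun s : ℂ => (δ : ℂ) ^ ((a : ℂ) - (s - D))) (D : ℂ) :=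
        (hpowA.analyticAt _).meromorphicAt
      refine MeromorphicAt.exists_tendsto_sub_div (by fun_prop) ?_
      have hc1 : Tendsto (fun s : ℂ => (δ : ℂ) ^ ((a : ℂ) - (s - D))) (𝓝[≠] (D : ℂ))
          (𝓝 ((δ : ℂ) ^ (a : ℂ))) := by
        have := (hpowA.continuous.tendsto (D : ℂ)).mono_left (nhdsWithin_le_nhds (s := {(D : ℂ)}ᶜ))
        simpa using this
      have hc2 : Tendsto (fun s : ℂ => s - (D : ℂ)) (𝓝[≠] (D : ℂ)) (𝓝 0) := by
        have := ((by fun_prop : Continuous fun s : ℂ => s - (D : ℂ)).tendsto (D : ℂ)).mono_left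
          (nhdsWithin_le_nhds (s := {(D : ℂ)}ᶜ))
        simpa using this
      have ha1 : (a : ℂ) - 0 ≠ 0 := by
        rw [sub_zero]
        exact_mod_cast ha0.ne'
      have h3 := ((hc1.mul hr).sub (hc2.mul_const (tubeVol N A Ω δ : ℂ))).div
        (hc2.const_sub (a : ℂ)) ha1
      rw [zero_mul, sub_zero, sub_zero] at h3
      refine h3.congr fun s => ?_
      simp only [hH, Pi.div_apply]
      ring
    · set ω : ℂ := D + τ * I with hω
      have hωre : ω.re = D := by simp [hω]
      have hωD : ω - D ≠ 0 := by simpa [hω] using hτ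
      obtain ⟨L, hL⟩ := (hF ω hωre).exists_tendsto_of_not_isPoleAt fun h =>
        hωD (sub_eq_zero.2 (hpole ω hωre h))
      have hs : Tendsto (fun s : ℂ => s - (D : ℂ)) (𝓝[≠] ω) (𝓝 (ω - D)) :=
        ((by fun_prop : Continuous fun s : ℂ => s - (D : ℂ)).tendsto ω).mono_left
          nhdsWithin_le_nhds
      have hc1 := (hpowA.continuous.tendsto ω).mono_left (nhdsWithin_le_nhds (s := {ω}ᶜ))
      exact ⟨_, (((hc1.mul hL).sub_const _).div (hs.const_sub _) (haz ω hωre)).sub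
        (tendsto_const_nhds.div hs hωD)⟩
  obtain ⟨L, hL⟩ := key
  have hmap : Tendsto (fun z : ℂ => (D : ℂ) + z) (𝓝[{z : ℂ | 0 < z.re}] (τ * I))
      (𝓝[≠] (D + τ * I)) := by
    refine tendsto_nhdsWithin_iff.2 ⟨?_, ?_⟩
    · exact ((by fun_prop : Continuous fun z : ℂ => (D : ℂ) + z).tendsto _).mono_left
        nhdsWithin_le_nhds
    · filter_upwards [self_mem_nhdsWithin] with z hz h
      have hz : 0 < z.re := hz
      have := congrArg re (mem_singleton_iff.1 h)
      simp at this
      linarith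
  refine ⟨L, (hL.comp hmap).congr' ?_⟩
  have hne : ∀ᶠ z : ℂ in 𝓝[{z : ℂ | 0 < z.re}] (τ * I), (a : ℂ) - z ≠ 0 := by
    have h4 : Tendsto (fun z : ℂ => (a : ℂ) - z) (𝓝[{z : ℂ | 0 < z.re}] (τ * I))
        (𝓝 ((a : ℂ) - τ * I)) :=
      ((by fun_prop : Continuous fun z : ℂ => (a : ℂ) - z).tendsto _).mono_left nhdsWithin_le_nhds
    refine h4.eventually_ne ?_
    have := haz (D + τ * I) (by simp)
    rwa [add_sub_cancel_left] at this
  filter_upwards [self_mem_nhdsWithin, hne] with z hz hz1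
  have hz : 0 < z.re := hz
  have h5 : F (D + z) = _ := (hFζ (D + z) (by simpa using hz)).trans
    (distZetaD_eq hδ hΩm hΩ hD hDN hz)
  simp only [Function.comp_apply, hH, add_sub_cancel_left, h5]
  congr 1
  rw [← mul_assoc, ← cpow_add _ _ hδ0, ← ha, sub_add_sub_cancel, sub_self, cpow_zero, one_mul,
    add_sub_cancel_left, mul_div_cancel_left₀ _ hz1]

end Criterion

/-- Minkowski measurability criterion in terms of `ζ_{A,Ω}`.
Let `(A,Ω)` be an RFD in `ℝ^N` with `D := dim_B(A,Ω)`, `D < N`, and fix `δ > 0`.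
Let `S` be a screen with `sup S < D`, `U` an open connected neighborhood of the window
`W`, and `F` a meromorphic extension of `ζ_{A,Ω}(·;δ)` to `U` satisfying (L1)–(L2)
with some exponent `κ_d`.  Assume the screen passes strictly between the critical line
`{Re s = D}` and all poles of `F` with real part `< D`.  Then `(A,Ω)` is Minkowski
measurable iff `D` is the only pole of `F` on `{Re s = D}` and it is simple; and in
that case `M^D(A,Ω) = r/(N−D)` where `r` is the residue of `F` at `D`. -/
theorem statement16
    (N : ℕ) (A Ω : Set (EuclideanSpace ℝ (Fin N))) (D δ : ℝ)
    (S : ℝ → ℝ) (U : Set ℂ) (F : ℂ → ℂ) (κd c C : ℝ) (T : ℤ → ℝ)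
    (hRFD : IsRFD N A Ω) (hD : IsMinkDim N A Ω D) (hDN : D < N) (hδ : 0 < δ)
    (hscreen : IsScreen S D) (hSbdd : BddAbove (Set.range S))
    (hSlt : sSup (Set.range S) < D)
    (hU : IsOpen U) (hUconn : IsPreconnected U) (hWU : window S ⊆ U)
    (hF : MeromorphicOn F U)
    (hFzeta : ∀ s ∈ U, D < s.re → F s = distZetaD N A Ω δ s)
    (hc : (N : ℝ) < c)
    (hlang : LanguidWith F S κd c C T)
    (hpoles : ∀ ω ∈ U, IsPoleAt F ω → ω.re < D → ω.re < S ω.im) :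
    ((∃ M : ℝ, MinkMeasurable N A Ω D M) ↔
      ((∃ r : ℂ, r ≠ 0 ∧
          Tendsto (fun s : ℂ => (s - (D : ℂ)) * F s)
            (nhdsWithin (D : ℂ) {(D : ℂ)}ᶜ) (nhds r)) ∧
        ∀ ω ∈ U, ω.re = D → IsPoleAt F ω → ω = (D : ℂ))) ∧
    ∀ r : ℂ,
      Tendsto (fun s : ℂ => (s - (D : ℂ)) * F s)
        (nhdsWithin (D : ℂ) {(D : ℂ)}ᶜ) (nhds r) →
      (∃ M : ℝ, MinkMeasurable N A Ω D M) →
      ∃ M : ℝ, MinkMeasurable N A Ω D M ∧ (M : ℂ) = r / ((N : ℂ) - (D : ℂ)) := by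
  obtain ⟨-, hΩm, hΩ, -⟩ := hRFD
  have hDu := hD.1
  have hUD : ∀ s : ℂ, D ≤ s.re → s ∈ U := fun s hs =>
    hWU (((le_csSup hSbdd (mem_range_self s.im)).trans hSlt.le).trans hs)
  have hFm : ∀ s : ℂ, s.re = D → MeromorphicAt F s := fun s hs => hF s (hUD s hs.ge)
  have hFζ : ∀ s : ℂ, D < s.re → F s = distZetaD N A Ω δ s := fun s hs =>
    hFzeta s (hUD s hs.le) hs
  have ha : 0 < (N : ℝ) - D := by linarith
  have hforward : ∀ M, MinkMeasurable N A Ω D M → ∀ τ : ℝ,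
      Tendsto (fun s : ℂ => (s - (D + τ * I)) * F s) (𝓝[≠] (D + τ * I))
        (𝓝 (if τ = 0 then ((((N : ℝ) - D) * M : ℝ) : ℂ) else 0)) := by
    intro M hM τ
    have hm := hFm (D + τ * I) (by simp)
    refine MeromorphicAt.tendsto_of_tendsto_add_ofReal (by fun_prop) ?_
    refine (tendsto_mul_distZetaD hδ hΩm hΩ hDu hDN hM τ).congr' ?_
    filter_upwards [self_mem_nhdsWithin] with t ht
    rw [add_sub_cancel_left, hFζ _ (by simpa using ht)]
    ring_nf
  have hforwardD : ∀ M, MinkMeasurable N A Ω D M →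
      Tendsto (fun s : ℂ => (s - D) * F s) (𝓝[≠] (D : ℂ))
        (𝓝 ((((N : ℝ) - D) * M : ℝ) : ℂ)) := by
    intro M hM
    simpa using hforward M hM 0
  refine ⟨⟨?_, ?_⟩, ?_⟩
  · rintro ⟨M, hM⟩
    refine ⟨⟨_, ofReal_ne_zero.2 (mul_pos ha hM.1).ne', hforwardD M hM⟩, ?_⟩
    intro ω _ hωre hpole
    have hω : ω = D + ω.im * I := by rw [← hωre, re_add_im]
    by_contra hne
    have him : ω.im ≠ 0 := fun h => hne (by rw [hω, h, ofReal_zero, zero_mul, add_zero])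
    have h1 := hforward M hM ω.im
    rw [if_neg him, ← hω] at h1
    obtain ⟨L, hL⟩ := (hFm ω hωre).exists_tendsto_of_sub_mul_tendsto_zero h1
    exact not_isPoleAt_of_tendsto hL hpole
  · rintro ⟨⟨r, hr0, hr⟩, hpole⟩
    have hlap := exists_tendsto_laplace_logTube_sub_div hδ hΩm hΩ hDu hDN hFm hFζ hr
      fun ω hω => hpole ω (hUD ω hω.ge) hω
    set b : ℂ := (δ : ℂ) ^ (((N : ℝ) - D : ℝ) : ℂ) * r / ((N : ℝ) - D : ℝ) with hb
    have hb0 : b ≠ 0 := by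
      have hδ0 : (δ : ℂ) ≠ 0 := by exact_mod_cast hδ.ne'
      have ha0 : (((N : ℝ) - D : ℝ) : ℂ) ≠ 0 := ofReal_ne_zero.2 ha.ne'
      exact div_ne_zero (mul_ne_zero (by simp [cpow_eq_zero_iff, hδ0]) hr0) ha0
    obtain ⟨m, hm0, hm⟩ := exists_ofReal_eq_of_tendsto_laplace_sub_div
      (logTube_nonneg (N := N) (A := A) (Ω := Ω) D δ) (by simpa using hlap 0)
    have hm0 : 0 < m := lt_of_le_of_ne hm0 fun h => hb0 (by rw [← hm, ← h, ofReal_zero])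
    rw [← hm] at hlap
    have hWI := wiener_ikehara (logTube_nonneg D δ) ha.le
      (fun x t _ ht => logTube_add_le hΩ hδ x t ht) (integrableOn_logTube hΩ hDu hδ) hlap
    exact ⟨_, div_pos hm0 (Real.rpow_pos_of_pos hδ _),
      tendsto_tubeVol_div_of_tendsto_logTube hδ hWI⟩
  · rintro r hr ⟨M, hM⟩
    refine ⟨M, hM, ?_⟩
    have ha0 : (N : ℂ) - D ≠ 0 := by exact_mod_cast ha.ne'
    rw [eq_div_iff ha0, tendsto_nhds_unique hr (hforwardD M hM)]
    push_cast
    ring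

end
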